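/- arXiv:1207.4856 — 3 statements merged into one kernel-verified Lean document; each statement's English description precedes it below -/
import Mathlib

section
/- In the resolution quiver of a Nakayama algebra, the map γ restricted to black vertices is injective: if S, S' are simple modules of projective dimension ≥ 2 with γS = γS', then S = S'. -/
universe u

variable (Λ : Type u) [Ring Λ]

section BasicDefs

variable (M : Type u) [AddCommGroup M] [Module Λ M]

/-- A module is uniserial if its submodules are linearly ordered by inclusion. -/
def IsUniserialMod : Prop := ∀ N N' : Submodule Λ M, N ≤ N' ∨ N' ≤ N

/-- A module is indecomposable if it is nonzero and admits no nontrivial direct sum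
decomposition. -/
def IsIndecomposableMod : Prop :=
  Nontrivial M ∧ ∀ N N' : Submodule Λ M, IsCompl N N' → N = ⊥ ∨ N' = ⊥

/-- The radical of a module: the intersection of all maximal submodules. -/
def modRadical : Submodule Λ M := sInf {N : Submodule Λ M | IsCoatom N}

/-- The socle of a module: the sum of all simple submodules. -/
def modSocle : Submodule Λ M := sSup {N : Submodule Λ M | IsAtom N}

/-- `HasLength Λ M n` : the module `M` has a composition series of length `n`. -/
def HasLength (n : ℕ) : Prop :=
  ∃ c : Fin (n + 1) → Submodule Λ M,
    c 0 = ⊥ ∧ c (Fin.last n) = ⊤ ∧ ∀ i : Fin n, c i.castSucc ⋖ c i.succ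

end BasicDefs

/-- A Nakayama algebra: an artinian ring all of whose finite-length indecomposable
(left) modules are uniserial. -/
class IsNakayama : Prop where
  artinian : IsArtinianRing Λ
  serial : ∀ (M : Type u) [AddCommGroup M] [Module Λ M],
    (∃ n, HasLength Λ M n) → IsIndecomposableMod Λ M → IsUniserialMod Λ M

/-- `Λ` has no simple projective module. -/
def NoSimpleProjectives : Prop :=
  ∀ (M : Type u) [AddCommGroup M] [Module Λ M], IsSimpleModule Λ M → ¬ Module.Projective Λ M

/-- `Λ` is connected: no nontrivial central idempotents. -/
def IsConnectedAlg : Prop :=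
  ∀ e : Λ, IsIdempotentElem e → (∀ x : Λ, e * x = x * e) → e = 0 ∨ e = 1

section Covers

variable {Λ}
variable {P M : Type u} [AddCommGroup P] [Module Λ P] [AddCommGroup M] [Module Λ M]

/-- `p : P → M` is a projective cover: `P` projective, `p` surjective with superfluous
kernel. -/
structure IsProjCover (p : P →ₗ[Λ] M) : Prop where
  projective : Module.Projective Λ P
  surjective : Function.Surjective p
  superfluous : LinearMap.ker p ≤ modRadical Λ P

end Covers

/-- `S` is (isomorphic to) the top `M/rad M` of `M`, and is simple. -/
def IsTopOf (S M : Type u) [AddCommGroup S] [Module Λ S] [AddCommGroup M] [Module Λ M] :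
    Prop :=
  IsSimpleModule Λ S ∧
    ∃ p : M →ₗ[Λ] S, Function.Surjective p ∧ LinearMap.ker p = modRadical Λ M

/-- `S` is (isomorphic to) the socle of `M`. -/
def IsSocleOf (S M : Type u) [AddCommGroup S] [Module Λ S] [AddCommGroup M] [Module Λ M] :
    Prop :=
  ∃ i : S →ₗ[Λ] M, Function.Injective i ∧ LinearMap.range i = modSocle Λ M

/-- `IsTauOf Λ T S` : `T` is the Auslander–Reiten translate `τ S` of the simple module `S`;
for a Nakayama algebra without simple projectives this means there is a length-2 module
with top `S` and socle `T`. -/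
def IsTauOf (T S : Type u) [AddCommGroup T] [Module Λ T] [AddCommGroup S] [Module Λ S] :
    Prop :=
  IsSimpleModule Λ S ∧ IsSimpleModule Λ T ∧
    ∃ L : ModuleCat.{u} Λ, HasLength Λ L 2 ∧ IsTopOf Λ S L ∧ IsSocleOf Λ T L

/-- `GammaRel Λ S T` : `T = γ S = τ soc P(S)` in the resolution quiver. -/
def GammaRel (S T : Type u) [AddCommGroup S] [Module Λ S] [AddCommGroup T] [Module Λ T] :
    Prop :=
  IsSimpleModule Λ S ∧
    ∃ (P : ModuleCat.{u} Λ) (p : P →ₗ[Λ] S), IsProjCover p ∧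
      ∃ V : ModuleCat.{u} Λ, IsSimpleModule Λ V ∧ IsSocleOf Λ V P ∧ IsTauOf Λ T V

/-- A simple module is black if its projective dimension is at least 2, i.e. the kernel of
its projective cover is not projective. -/
def IsBlackSimple (S : Type u) [AddCommGroup S] [Module Λ S] : Prop :=
  IsSimpleModule Λ S ∧
    ∀ (P : ModuleCat.{u} Λ) (p : P →ₗ[Λ] S), IsProjCover p →
      ¬ Module.Projective Λ (LinearMap.ker p)

/-- A simple module is red if it has projective dimension exactly 1, i.e. the kernel of its
projective cover is projective. -/
def IsRedSimple (S : Type u) [AddCommGroup S] [Module Λ S] : Prop :=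
  IsSimpleModule Λ S ∧
    ∃ (P : ModuleCat.{u} Λ) (p : P →ₗ[Λ] S), IsProjCover p ∧
      Module.Projective Λ (LinearMap.ker p)

/-- A simple module is cyclically black if it lies on a cycle of the resolution quiver all
of whose vertices are black. -/
def IsCyclicallyBlack (S : Type u) [AddCommGroup S] [Module Λ S] : Prop :=
  ∃ (n : ℕ) (C : ℕ → ModuleCat.{u} Λ), 0 < n ∧
    Nonempty ((C 0 : Type u) ≃ₗ[Λ] S) ∧ Nonempty ((C n : Type u) ≃ₗ[Λ] S) ∧
    (∀ i < n, GammaRel Λ (C i) (C (i + 1))) ∧ ∀ i ≤ n, IsBlackSimple Λ (C i)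

/-- An indecomposable projective module is minimal projective if its radical is not
projective. -/
def IsMinimalProjective (P : Type u) [AddCommGroup P] [Module Λ P] : Prop :=
  Module.Projective Λ P ∧ IsIndecomposableMod Λ P ∧
    ¬ Module.Projective Λ (modRadical Λ P)

/-- `M` is Gorenstein projective: it is an image in a complete projective resolution, i.e.
an exact complex of projectives which stays exact after applying `Hom(-, Λ)`. -/
def IsGorensteinProjective (M : Type u) [AddCommGroup M] [Module Λ M] : Prop :=
  ∃ (P : ℤ → ModuleCat.{u} Λ) (d : ∀ i, P (i + 1) →ₗ[Λ] P i),
    (∀ i, Module.Projective Λ (P i)) ∧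
    (∀ i, Function.Exact (d (i + 1)) (d i)) ∧
    (∀ (i : ℤ) (φ : P (i + 1) →ₗ[Λ] Λ), φ.comp (d (i + 1)) = 0 →
      ∃ ψ : P i →ₗ[Λ] Λ, ψ.comp (d i) = φ) ∧
    Nonempty (M ≃ₗ[Λ] LinearMap.range (d 0))

/-- `M` has a finite projective resolution. -/
def HasFinitePD (M : Type u) [AddCommGroup M] [Module Λ M] : Prop :=
  ∃ (n : ℕ) (P : ℕ → ModuleCat.{u} Λ) (d : ∀ i, P (i + 1) →ₗ[Λ] P i)
      (ε : P 0 →ₗ[Λ] M),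
    (∀ i, Module.Projective Λ (P i)) ∧ Function.Surjective ε ∧
    Function.Exact (d 0) ε ∧ (∀ i, Function.Exact (d (i + 1)) (d i)) ∧
    ∀ i, n < i → Subsingleton (P i)

/-- `M` has injective dimension at most `n` (over the ring `Λ`). -/
def InjDimLE (M : Type u) [AddCommGroup M] [Module Λ M] (n : ℕ) : Prop :=
  ∃ (I : ℕ → ModuleCat.{u} Λ) (η : M →ₗ[Λ] I 0) (d : ∀ i, I i →ₗ[Λ] I (i + 1)),
    (∀ i, Module.Injective Λ (I i)) ∧ Function.Injective η ∧
    Function.Exact η (d 0) ∧ (∀ i, Function.Exact (d i) (d (i + 1))) ∧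
    ∀ i, n < i → Subsingleton (I i)

/-- `Λ` is a Gorenstein algebra: finite injective dimension as a left and right module
over itself. -/
def IsGorensteinAlg : Prop :=
  (∃ n, InjDimLE Λ Λ n) ∧ ∃ n, InjDimLE Λᵐᵒᵖ Λ n

/-- Every cycle of the resolution quiver consists of black vertices. -/
def AllCyclesBlack : Prop :=
  ∀ (n : ℕ) (C : ℕ → ModuleCat.{u} Λ), 0 < n →
    (∀ i < n, GammaRel Λ (C i) (C (i + 1))) →
    Nonempty ((C n : Type u) ≃ₗ[Λ] (C 0 : Type u)) →
    ∀ i ≤ n, IsBlackSimple Λ (C i)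

/-- Every cycle of the resolution quiver contains a red vertex. -/
def EveryCycleHasRed : Prop :=
  ∀ (n : ℕ) (C : ℕ → ModuleCat.{u} Λ), 0 < n →
    (∀ i < n, GammaRel Λ (C i) (C (i + 1))) →
    Nonempty ((C n : Type u) ≃ₗ[Λ] (C 0 : Type u)) →
    ∃ i ≤ n, IsRedSimple Λ (C i)

/-- `Λ` is CM-free: every finite-length Gorenstein projective module is projective. -/
def IsCMFree : Prop :=
  ∀ (M : Type u) [AddCommGroup M] [Module Λ M],
    (∃ n, HasLength Λ M n) → IsGorensteinProjective Λ M → Module.Projective Λ M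

/-- `Λ` has exactly `s` isomorphism classes of simple modules. -/
def SimpleCount (s : ℕ) : Prop :=
  ∃ F : Fin s → ModuleCat.{u} Λ,
    (∀ i, IsSimpleModule Λ (F i)) ∧
    (∀ i j, i ≠ j → IsEmpty ((F i : Type u) ≃ₗ[Λ] (F j : Type u))) ∧
    ∀ (S : Type u) [AddCommGroup S] [Module Λ S], IsSimpleModule Λ S →
      ∃ i, Nonempty (S ≃ₗ[Λ] (F i : Type u))

/-- Every (finite length) indecomposable projective module has length `> s`;
this is the condition `p > s`. -/
def MinProjLengthGT (s : ℕ) : Prop :=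
  ∀ (P : Type u) [AddCommGroup P] [Module Λ P],
    Module.Projective Λ P → IsIndecomposableMod Λ P →
      ∀ n, HasLength Λ P n → s < n

/-- An elementary Gorenstein projective module: nonzero, Gorenstein projective,
non-projective, and no proper nonzero factor module is Gorenstein projective. -/
def IsElementary (E : Type u) [AddCommGroup E] [Module Λ E] : Prop :=
  Nontrivial E ∧ (∃ n, HasLength Λ E n) ∧ IsGorensteinProjective Λ E ∧
    ¬ Module.Projective Λ E ∧
    ∀ N : Submodule Λ E, N ≠ ⊥ → N ≠ ⊤ → ¬ IsGorensteinProjective Λ (E ⧸ N)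

/-- `m` is the multiplicity of the simple module `S` as a composition factor of `M`. -/
def MultiplicityOf (S M : Type u) [AddCommGroup S] [Module Λ S] [AddCommGroup M]
    [Module Λ M] (m : ℕ) : Prop :=
  ∃ (n : ℕ) (c : Fin (n + 1) → Submodule Λ M),
    c 0 = ⊥ ∧ c (Fin.last n) = ⊤ ∧ (∀ i : Fin n, c i.castSucc ⋖ c i.succ) ∧
    m = Nat.card {i : Fin n //
      Nonempty ((↥(c i.succ) ⧸ (c i.castSucc).comap (c i.succ).subtype) ≃ₗ[Λ] S)}

/-- From `S`, the cycles of the resolution quiver can be reached (in a black-cycle vertex)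
in `m` steps. -/
def ReachesBlackIn (S : Type u) [AddCommGroup S] [Module Λ S] (m : ℕ) : Prop :=
  ∃ C : ℕ → ModuleCat.{u} Λ, Nonempty ((C 0 : Type u) ≃ₗ[Λ] S) ∧
    (∀ i < m, GammaRel Λ (C i) (C (i + 1))) ∧ IsCyclicallyBlack Λ (C m)

/-- `d` is the maximal distance of a vertex of the resolution quiver to the black cycles. -/
def MaxDistToBlack (d : ℕ) : Prop :=
  (∀ (S : Type u) [AddCommGroup S] [Module Λ S], IsSimpleModule Λ S →
      ∃ m ≤ d, ReachesBlackIn Λ S m) ∧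
  ∃ S : ModuleCat.{u} Λ, IsSimpleModule Λ S ∧ ∀ m < d, ¬ ReachesBlackIn Λ (S : Type u) m

/-! ### Auxiliary lemmas -/

theorem aux_hasLength (M : Type u) [AddCommGroup M] [Module Λ M] (h : IsFiniteLength Λ M) :
    ∃ n, HasLength Λ M n := by
  obtain ⟨s, h0, h1⟩ := isFiniteLength_iff_exists_compositionSeries.mp h
  exact ⟨s.length, fun i => s i, h0, h1, fun i => s.step i⟩

theorem aux_length (M : Type u) [AddCommGroup M] [Module Λ M] (n : ℕ) (h : HasLength Λ M n) :
    IsFiniteLength Λ M ∧ Module.length Λ M = n := by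
  obtain ⟨c, h0, h1, h2⟩ := h
  let s : CompositionSeries (Submodule Λ M) := ⟨n, c, h2⟩
  refine ⟨isFiniteLength_iff_exists_compositionSeries.mpr ⟨s, h0, h1⟩, ?_⟩
  exact (Module.length_compositionSeries s h0 h1).symm

/-- If a property passes to one of the two summands in any direct decomposition, then it is
realized by a module without nontrivial decompositions. -/
theorem aux_indec (C : ModuleCat.{u} Λ → Prop)
    (hC : ∀ X : ModuleCat.{u} Λ, C X → ∀ A B : Submodule Λ X, IsCompl A B →
      C (ModuleCat.of Λ A) ∨ C (ModuleCat.of Λ B))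
    (X : ModuleCat.{u} Λ) (hX : IsFiniteLength Λ X) (h : C X) :
    ∃ Y : ModuleCat.{u} Λ, IsFiniteLength Λ Y ∧ C Y ∧
      ∀ A B : Submodule Λ Y, IsCompl A B → A = ⊥ ∨ B = ⊥ := by
  generalize hn : Module.length Λ X = n
  induction n using WellFoundedLT.induction generalizing X with
  | ind n ih =>
    by_cases hd : ∀ A B : Submodule Λ X, IsCompl A B → A = ⊥ ∨ B = ⊥
    · exact ⟨X, hX, h, hd⟩
    push Not at hd
    obtain ⟨A, B, hAB, hA, hB⟩ := hd
    have hX' := isFiniteLength_iff_isNoetherian_isArtinian.mp hX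
    have := hX'.1
    have := hX'.2
    have hA' : A ≠ ⊤ := fun e => hB (by simpa [e] using hAB.inf_eq_bot)
    have hB' : B ≠ ⊤ := fun e => hA (by simpa [e] using hAB.inf_eq_bot)
    rcases hC X h A B hAB with hc | hc
    · exact ih _ (hn ▸ Submodule.length_lt hA') (ModuleCat.of Λ A)
        (hX.of_injective (f := A.subtype) A.injective_subtype) hc rfl
    · exact ih _ (hn ▸ Submodule.length_lt hB') (ModuleCat.of Λ B)
        (hX.of_injective (f := B.subtype) B.injective_subtype) hc rfl

/-- A module map which is injective on the socle is injective. -/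
theorem aux_inj_socle (T L X : Type u) [AddCommGroup T] [Module Λ T] [AddCommGroup L]
    [Module Λ L] [AddCommGroup X] [Module Λ X] (hL : IsFiniteLength Λ L)
    (i : T →ₗ[Λ] L) (hi : LinearMap.range i = modSocle Λ L) (f : L →ₗ[Λ] X)
    (hf : Function.Injective (f ∘ₗ i)) : Function.Injective f := by
  have := (isFiniteLength_iff_isNoetherian_isArtinian.mp hL).2
  rw [← LinearMap.ker_eq_bot]
  rcases eq_bot_or_exists_atom_le (LinearMap.ker f) with h | ⟨a, ha, hle⟩
  · exact h
  exfalso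
  apply ha.1
  rw [eq_bot_iff]
  intro x hx
  have h1 : x ∈ LinearMap.range i := by
    rw [hi]; exact (le_sSup (show a ∈ {N : Submodule Λ L | IsAtom N} from ha)) hx
  obtain ⟨t, rfl⟩ := h1
  have h2 : (f ∘ₗ i) t = (f ∘ₗ i) 0 := by simpa using hle hx
  rw [hf h2]; simp

theorem aux_factor (L L' X : Type u) [AddCommGroup L] [Module Λ L] [AddCommGroup L']
    [Module Λ L'] [AddCommGroup X] [Module Λ X] (f : L →ₗ[Λ] X) (g : L' →ₗ[Λ] X)
    (hf : Function.Injective f) (hg : Function.Injective g)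
    (h : LinearMap.range f ≤ LinearMap.range g) :
    ∃ k : L →ₗ[Λ] L', Function.Injective k := by
  refine ⟨(LinearEquiv.ofInjective g hg).symm.toLinearMap ∘ₗ
    (f.codRestrict (LinearMap.range g) (fun x => h ⟨x, rfl⟩)), ?_⟩
  refine (LinearEquiv.ofInjective g hg).symm.injective.comp ?_
  intro x y hxy
  exact hf (congrArg Subtype.val hxy)

/-- Two finite length modules with isomorphic simple socle: one embeds into the other. -/
theorem aux_embed [IsNakayama Λ] (T L L' : Type u) [AddCommGroup T] [Module Λ T]
    [AddCommGroup L] [Module Λ L] [AddCommGroup L'] [Module Λ L'] (hT : IsSimpleModule Λ T)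
    (hL : IsFiniteLength Λ L) (hL' : IsFiniteLength Λ L')
    (h : IsSocleOf Λ T L) (h' : IsSocleOf Λ T L') :
    (∃ k : L →ₗ[Λ] L', Function.Injective k) ∨ (∃ k : L' →ₗ[Λ] L, Function.Injective k) := by
  obtain ⟨i, hi, hri⟩ := h
  obtain ⟨i', hi', hri'⟩ := h'
  let D : Submodule Λ (L × L') := LinearMap.range (i.prod (-i'))
  let a : L →ₗ[Λ] ((L × L') ⧸ D) := D.mkQ ∘ₗ LinearMap.inl Λ L L'
  let b : L' →ₗ[Λ] ((L × L') ⧸ D) := D.mkQ ∘ₗ LinearMap.inr Λ L L'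
  have hab : a ∘ₗ i = b ∘ₗ i' := by
    ext t
    change D.mkQ (i t, 0) = D.mkQ (0, i' t)
    rw [← sub_eq_zero, ← map_sub, Submodule.mkQ_apply, Submodule.Quotient.mk_eq_zero]
    exact ⟨t, by simp⟩
  have hai : Function.Injective (a ∘ₗ i) := by
    rw [← LinearMap.ker_eq_bot, eq_bot_iff]
    intro t ht
    have ht' : D.mkQ (i t, 0) = 0 := ht
    rw [Submodule.mkQ_apply, Submodule.Quotient.mk_eq_zero] at ht'
    obtain ⟨s, hs⟩ := ht'
    have hs1 : i s = i t := congrArg Prod.fst hs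
    have hs2 : -i' s = 0 := congrArg Prod.snd hs
    have hs0 : s = 0 := hi' (by simpa using hs2)
    rw [hs0] at hs1
    rw [Submodule.mem_bot]
    exact (hi hs1).symm
  have hM : IsFiniteLength Λ ((L × L') ⧸ D) := by
    have h1 := isFiniteLength_iff_isNoetherian_isArtinian.mp hL
    have h2 := isFiniteLength_iff_isNoetherian_isArtinian.mp hL'
    have := h1.1; have := h1.2; have := h2.1; have := h2.2
    exact isFiniteLength_iff_isNoetherian_isArtinian.mpr ⟨inferInstance, inferInstance⟩
  obtain ⟨X, hX, ⟨f, hf⟩, hdec⟩ := aux_indec Λ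
    (fun X => ∃ f : ((L × L') ⧸ D) →ₗ[Λ] X, Function.Injective (f ∘ₗ a ∘ₗ i)) (by
      rintro X ⟨f, hf⟩ A B hAB
      rcases LinearMap.injective_or_eq_zero
        ((A.projectionOnto B hAB ∘ₗ f) ∘ₗ a ∘ₗ i) with h1 | h1
      · exact Or.inl ⟨A.projectionOnto B hAB ∘ₗ f, h1⟩
      rcases LinearMap.injective_or_eq_zero
        ((B.projectionOnto A hAB.symm ∘ₗ f) ∘ₗ a ∘ₗ i) with h2 | h2
      · exact Or.inr ⟨B.projectionOnto A hAB.symm ∘ₗ f, h2⟩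
      exfalso
      have := hT.nontrivial
      obtain ⟨t, ht⟩ := exists_ne (0 : T)
      apply ht
      apply hf
      have e1 : A.projectionOnto B hAB (f (a (i t))) = 0 := LinearMap.congr_fun h1 t
      have e2 : B.projectionOnto A hAB.symm (f (a (i t))) = 0 := LinearMap.congr_fun h2 t
      rw [Submodule.projectionOnto_apply_eq_zero_iff] at e1 e2
      have e3 : f (a (i t)) ∈ A ⊓ B := ⟨e2, e1⟩
      rw [hAB.inf_eq_bot, Submodule.mem_bot] at e3
      simpa using e3)
    (ModuleCat.of Λ ((L × L') ⧸ D)) hM ⟨LinearMap.id, hai⟩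
  have hfa : Function.Injective (f ∘ₗ a) := aux_inj_socle Λ T L X hL i hri _ hf
  have hfb : Function.Injective (f ∘ₗ b) := by
    refine aux_inj_socle Λ T L' X hL' i' hri' _ ?_
    rw [LinearMap.comp_assoc, ← hab]; exact hf
  have hnt : Nontrivial X := by
    have := hT.nontrivial
    exact hf.nontrivial
  rcases IsNakayama.serial X (aux_hasLength Λ X hX) ⟨hnt, hdec⟩
    (LinearMap.range (f ∘ₗ a)) (LinearMap.range (f ∘ₗ b)) with hle | hle
  · exact Or.inl (aux_factor Λ _ _ _ _ _ hfa hfb hle)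
  · exact Or.inr (aux_factor Λ _ _ _ _ _ hfb hfa hle)

/-- Quotients of isomorphic modules by the unique maximal submodule are isomorphic. -/
theorem aux_top (P P' S S' : Type u) [AddCommGroup P] [Module Λ P] [AddCommGroup P']
    [Module Λ P'] [AddCommGroup S] [Module Λ S] [AddCommGroup S'] [Module Λ S']
    (hS : IsSimpleModule Λ S) (hS' : IsSimpleModule Λ S')
    (e : P →ₗ[Λ] P') (he : Function.Surjective e) (p : P →ₗ[Λ] S) (p' : P' →ₗ[Λ] S')
    (hp : Function.Surjective p) (hp' : Function.Surjective p')
    (hr : LinearMap.ker p ≤ modRadical Λ P) : Nonempty (S ≃ₗ[Λ] S') := by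
  have hq : Function.Surjective (p' ∘ₗ e) := hp'.comp he
  have c1 := LinearMap.isCoatom_ker_of_surjective hp
  have c2 := LinearMap.isCoatom_ker_of_surjective hq
  have hle : LinearMap.ker p ≤ LinearMap.ker (p' ∘ₗ e) :=
    hr.trans (sInf_le c2)
  have heq : LinearMap.ker p = LinearMap.ker (p' ∘ₗ e) :=
    (c1.le_iff_eq c2.1).mp hle |>.symm
  exact ⟨(p.quotKerEquivOfSurjective hp).symm ≪≫ₗ Submodule.quotEquivOfEq _ _ heq ≪≫ₗ
    ((p' ∘ₗ e).quotKerEquivOfSurjective hq)⟩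

/-- Over an artinian ring every nonzero module has a maximal submodule. -/
theorem aux_coatom [IsArtinianRing Λ] (M : Type u) [AddCommGroup M] [Module Λ M] :
    Nontrivial M → ∃ N : Submodule Λ M, IsCoatom N := by
  refine IsSemiprimaryRing.induction (R₀ := Λ) (R := Λ) (M := M)
    (P := fun M _ _ _ => Nontrivial M → ∃ N : Submodule Λ M, IsCoatom N) ?_ ?_
  · intro M _ _ _ _ _ _ _
    rcases eq_top_or_exists_le_coatom (⊥ : Submodule Λ M) with h | ⟨N, hN, _⟩
    · exact absurd h bot_ne_top
    · exact ⟨N, hN⟩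
  · intro M _ _ _ _ N hN hQ hnt
    by_cases h : N = ⊤
    · have : Nontrivial N := by rw [h]; exact Submodule.topEquiv.toEquiv.nontrivial
      obtain ⟨K, hK⟩ := hN this
      let e : N ≃ₗ[Λ] M := LinearEquiv.ofTop N h
      exact ⟨K.map (e : N →ₗ[Λ] M), ((Submodule.orderIsoMapComap e).isCoatom_iff K).mpr hK⟩
    · have : Nontrivial (M ⧸ N) := Submodule.Quotient.nontrivial_iff.mpr h
      obtain ⟨K, hK⟩ := hQ this
      have := isSimpleModule_iff_isCoatom.mpr hK
      exact ⟨_, LinearMap.isCoatom_ker_of_surjective (f := K.mkQ ∘ₗ N.mkQ)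
        (K.mkQ_surjective.comp N.mkQ_surjective)⟩

/-- In a projective cover of a simple module every proper submodule lies in the kernel. -/
theorem aux_proper [IsArtinianRing Λ] (P S : Type u) [AddCommGroup P] [Module Λ P]
    [AddCommGroup S] [Module Λ S] (hS : IsSimpleModule Λ S) (p : P →ₗ[Λ] S)
    (hp : IsProjCover p) (N : Submodule Λ P) (hN : N ≠ ⊤) : N ≤ LinearMap.ker p := by
  obtain ⟨K, hK⟩ := aux_coatom Λ (P ⧸ N) (Submodule.Quotient.nontrivial_iff.mpr hN)
  have := isSimpleModule_iff_isCoatom.mpr hK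
  have hc := LinearMap.isCoatom_ker_of_surjective (f := K.mkQ ∘ₗ N.mkQ)
        (K.mkQ_surjective.comp N.mkQ_surjective)
  have c1 := LinearMap.isCoatom_ker_of_surjective hp.surjective
  have hle := hp.superfluous.trans (sInf_le hc)
  rw [← (c1.le_iff_eq hc.1).mp hle]
  intro x hx
  have hx0 : N.mkQ x = 0 := by simpa using hx
  rw [LinearMap.mem_ker, LinearMap.comp_apply, hx0, map_zero]

theorem aux_finLength [IsArtinianRing Λ] (P S : Type u) [AddCommGroup P] [Module Λ P]
    [AddCommGroup S] [Module Λ S] (hS : IsSimpleModule Λ S) (p : P →ₗ[Λ] S)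
    (hp : IsProjCover p) : IsFiniteLength Λ P := by
  have := hS.nontrivial
  obtain ⟨s, hs⟩ := exists_ne (0 : S)
  obtain ⟨x, rfl⟩ := hp.surjective s
  have hx : LinearMap.range (LinearMap.toSpanSingleton Λ P x) = ⊤ := by
    by_contra hne
    exact hs (aux_proper Λ P S hS p hp _ hne ⟨1, by simp⟩)
  have h0 : IsFiniteLength Λ Λ :=
    isFiniteLength_iff_isNoetherian_isArtinian.mpr ⟨inferInstance, inferInstance⟩
  exact h0.of_surjective (LinearMap.range_eq_top.mp hx)

theorem aux_uniserial [IsNakayama Λ] (P S : Type u) [AddCommGroup P] [Module Λ P]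
    [AddCommGroup S] [Module Λ S] (hS : IsSimpleModule Λ S) (p : P →ₗ[Λ] S)
    (hp : IsProjCover p) : IsUniserialMod Λ P := by
  have := IsNakayama.artinian (Λ := Λ)
  have := hS.nontrivial
  refine IsNakayama.serial P (aux_hasLength Λ P (aux_finLength Λ P S hS p hp))
    ⟨hp.surjective.nontrivial, fun A B hAB => ?_⟩
  by_contra hcon
  push Not at hcon
  have hA' : A ≠ ⊤ := fun e => hcon.2 (by simpa [e] using hAB.inf_eq_bot)
  have hB' : B ≠ ⊤ := fun e => hcon.1 (by simpa [e] using hAB.inf_eq_bot)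
  have h1 := sup_le (aux_proper Λ P S hS p hp A hA') (aux_proper Λ P S hS p hp B hB')
  rw [hAB.sup_eq_top] at h1
  exact (LinearMap.isCoatom_ker_of_surjective hp.surjective).1 (top_le_iff.mp h1)

/-- A uniserial finite length module containing a nonzero projective module is projective. -/
theorem aux_proj [IsNakayama Λ] (P K : Type u) [AddCommGroup P] [Module Λ P]
    [AddCommGroup K] [Module Λ K] (hK : IsFiniteLength Λ K) (hu : IsUniserialMod Λ K)
    (hP : Module.Projective Λ P) (hnt : Nontrivial P) (g : P →ₗ[Λ] K)
    (hg : Function.Injective g) : Module.Projective Λ K := by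
  have := IsNakayama.artinian (Λ := Λ)
  have := (isFiniteLength_iff_isNoetherian_isArtinian.mp hK).1
  obtain ⟨n, f0, hf0⟩ := Module.Finite.exists_fin' Λ K
  obtain ⟨Q, hQ, ⟨hQp, f, hf⟩, hdec⟩ := aux_indec Λ
    (fun X => Module.Projective Λ X ∧ ∃ f : X →ₗ[Λ] K, Function.Surjective f) (by
      rintro X ⟨hX, f, hf⟩ A B hAB
      have hA : Module.Projective Λ A := Module.Projective.of_split A.subtype
        (A.projectionOnto B hAB) (Submodule.projectionOnto_comp_subtype hAB)
      have hB : Module.Projective Λ B := Module.Projective.of_split B.subtype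
        (B.projectionOnto A hAB.symm) (Submodule.projectionOnto_comp_subtype hAB.symm)
      have htop : A.map f ⊔ B.map f = ⊤ := by
        rw [← Submodule.map_sup, hAB.sup_eq_top, Submodule.map_top, LinearMap.range_eq_top.mpr hf]
      rcases hu (A.map f) (B.map f) with h | h
      · right
        rw [sup_eq_right.mpr h] at htop
        refine ⟨hB, f ∘ₗ B.subtype, ?_⟩
        rw [← LinearMap.range_eq_top, LinearMap.range_comp, Submodule.range_subtype, htop]
      · left
        rw [sup_eq_left.mpr h] at htop
        refine ⟨hA, f ∘ₗ A.subtype, ?_⟩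
        rw [← LinearMap.range_eq_top, LinearMap.range_comp, Submodule.range_subtype, htop])
    (ModuleCat.of Λ (Fin n → Λ))
    (isFiniteLength_iff_isNoetherian_isArtinian.mpr
      ⟨inferInstanceAs (IsNoetherian Λ (Fin n → Λ)), inferInstanceAs (IsArtinian Λ (Fin n → Λ))⟩)
    ⟨inferInstanceAs (Module.Projective Λ (Fin n → Λ)), f0, hf0⟩
  obtain ⟨h, hh⟩ := Module.projective_lifting_property f g hf
  have hhi : ∀ x, f (h x) = g x := fun x => LinearMap.congr_fun hh x
  have hinj : Function.Injective h := fun x y hxy => hg (by rw [← hhi, ← hhi, hxy])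
  have hQn : Nontrivial Q := hinj.nontrivial
  have hker : LinearMap.ker f = ⊥ := by
    rcases IsNakayama.serial Q (aux_hasLength Λ Q hQ) ⟨hQn, hdec⟩
      (LinearMap.ker f) (LinearMap.range h) with hle | hle
    · rw [eq_bot_iff]
      intro x hx
      obtain ⟨y, rfl⟩ := hle hx
      have h1 : g y = g 0 := by rw [← hhi, map_zero]; exact hx
      rw [hg h1]; simp
    · exfalso
      obtain ⟨y, hy⟩ := exists_ne (0 : P)
      apply hy
      apply hg
      rw [← hhi, map_zero]
      exact hle ⟨y, rfl⟩
  exact Module.Projective.of_equiv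
    (LinearEquiv.ofBijective f ⟨LinearMap.ker_eq_bot.mp hker, hf⟩)

/-- An embedding of projective covers of simples, with black target, forces equal tops. -/
theorem aux_main [IsNakayama Λ] (P P' S S' : Type u) [AddCommGroup P] [Module Λ P]
    [AddCommGroup P'] [Module Λ P'] [AddCommGroup S] [Module Λ S] [AddCommGroup S']
    [Module Λ S'] (hS : IsSimpleModule Λ S) (hS' : IsSimpleModule Λ S')
    (p : P →ₗ[Λ] S) (p' : P' →ₗ[Λ] S') (hp : IsProjCover p) (hp' : IsProjCover p')
    (hb : ¬ Module.Projective Λ (LinearMap.ker p')) (g : P →ₗ[Λ] P')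
    (hg : Function.Injective g) : Nonempty (S ≃ₗ[Λ] S') := by
  have := IsNakayama.artinian (Λ := Λ)
  by_cases hs : LinearMap.range g = ⊤
  · exact aux_top Λ P P' S S' hS hS' g (LinearMap.range_eq_top.mp hs) p p' hp.surjective
      hp'.surjective hp.superfluous
  exfalso
  apply hb
  have hle := aux_proper Λ P' S' hS' p' hp' _ hs
  have := hS.nontrivial
  refine aux_proj Λ P (LinearMap.ker p')
    ((aux_finLength Λ P' S' hS' p' hp').of_injective (Submodule.injective_subtype _)) ?_
    hp.projective hp.surjective.nontrivial
    (g.codRestrict _ (fun x => hle ⟨x, rfl⟩)) (fun x y hxy => hg (congrArg Subtype.val hxy))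
  intro A B
  have hinj := Submodule.map_injective_of_injective
    (Submodule.injective_subtype (LinearMap.ker p'))
  rcases aux_uniserial Λ P' S' hS' p' hp' (A.map (Submodule.subtype _))
    (B.map (Submodule.subtype _)) with h | h
  · exact Or.inl ((Submodule.map_le_map_iff_of_injective
      (Submodule.injective_subtype _) A B).mp h)
  · exact Or.inr ((Submodule.map_le_map_iff_of_injective
      (Submodule.injective_subtype _) B A).mp h)

/-- An injection between modules of the same finite length is surjective. -/
theorem aux_surj (L L' : Type u) [AddCommGroup L] [Module Λ L] [AddCommGroup L'] [Module Λ L']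
    (n : ℕ) (hL : HasLength Λ L n) (hL' : HasLength Λ L' n) (k : L →ₗ[Λ] L')
    (hk : Function.Injective k) : Function.Surjective k := by
  obtain ⟨f1, l1⟩ := aux_length Λ L n hL
  obtain ⟨f2, l2⟩ := aux_length Λ L' n hL'
  have h2 := isFiniteLength_iff_isNoetherian_isArtinian.mp f2
  have := h2.1
  have := h2.2
  rw [← LinearMap.range_eq_top]
  by_contra hne
  have hlt := Submodule.length_lt hne
  rw [← (LinearEquiv.ofInjective k hk).length_eq, l1, l2] at hlt
  exact lt_irrefl _ hlt

/-- `τ` is injective on simple modules. -/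
theorem aux_tau [IsNakayama Λ] (T V V' : Type u) [AddCommGroup T] [Module Λ T]
    [AddCommGroup V] [Module Λ V] [AddCommGroup V'] [Module Λ V']
    (h : IsTauOf Λ T V) (h' : IsTauOf Λ T V') : Nonempty (V ≃ₗ[Λ] V') := by
  obtain ⟨hV, hT, L, hL, ⟨_, q, hq, hqr⟩, hs⟩ := h
  obtain ⟨hV', _, L', hL', ⟨_, q', hq', hqr'⟩, hs'⟩ := h'
  rcases aux_embed Λ T L L' hT (aux_length Λ L 2 hL).1 (aux_length Λ L' 2 hL').1 hs hs' with
    ⟨k, hk⟩ | ⟨k, hk⟩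
  · exact aux_top Λ L L' V V' hV hV' k (aux_surj Λ L L' 2 hL hL' k hk) q q' hq hq' hqr.le
  · obtain ⟨e⟩ := aux_top Λ L' L V' V hV' hV k (aux_surj Λ L' L 2 hL' hL k hk) q' q hq' hq
      hqr'.le
    exact ⟨e.symm⟩

/-- In the resolution quiver of a Nakayama algebra, the map `γ = τ soc P(-)` restricted to
black vertices is injective: if `S, S'` are simple modules of projective dimension `≥ 2`
with `γ S = γ S'`, then `S ≅ S'`. -/
theorem gamma_injective_on_black [IsNakayama Λ] (h0 : NoSimpleProjectives Λ)
    (S S' T : Type u) [AddCommGroup S] [Module Λ S] [AddCommGroup S'] [Module Λ S']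
    [AddCommGroup T] [Module Λ T]
    (hS : IsBlackSimple Λ S) (hS' : IsBlackSimple Λ S') (hT : IsSimpleModule Λ T)
    (h1 : GammaRel Λ S T) (h2 : GammaRel Λ S' T) :
    Nonempty (S ≃ₗ[Λ] S') := by
  have := IsNakayama.artinian (Λ := Λ)
  obtain ⟨hSs, P, p, hp, V, hV, hsoc, htau⟩ := h1
  obtain ⟨hSs', P', p', hp', V', hV', ⟨i', hi', hr'⟩, htau'⟩ := h2
  obtain ⟨e⟩ := aux_tau Λ T V V' htau htau'
  have hsoc' : IsSocleOf Λ V P' := by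
    refine ⟨i' ∘ₗ e.toLinearMap, hi'.comp e.injective, ?_⟩
    rw [LinearMap.range_comp, LinearEquiv.range, Submodule.map_top, hr']
  rcases aux_embed Λ V P P' hV (aux_finLength Λ P S hSs p hp)
    (aux_finLength Λ P' S' hSs' p' hp') hsoc hsoc' with ⟨k, hk⟩ | ⟨k, hk⟩
  · exact aux_main Λ P P' S S' hSs hSs' p p' hp hp' (hS'.2 P' p' hp') k hk
  · obtain ⟨e'⟩ := aux_main Λ P' P S' S hSs' hSs p' p hp' hp (hS.2 P p hp) k hk
    exact ⟨e'.symm⟩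
end

section
/- If S is a simple module over a Nakayama algebra with |P(S)| > s (where s is the number of simples), then |P(γS)| ≥ s and Ω²(H(S)) ≅ H(γS), where H(S) is the length-s top quotient of P(S). -/
universe u

variable (Λ : Type u) [Ring Λ]

namespace Nak

section General

variable {Λ}
variable {M N X Y : Type u} [AddCommGroup M] [Module Λ M] [AddCommGroup N] [Module Λ N]
  [AddCommGroup X] [Module Λ X] [AddCommGroup Y] [Module Λ Y]

theorem exists_coatom_of_nontrivial [IsArtinianRing Λ] (M : Type u) [AddCommGroup M] [Module Λ M] :
    Nontrivial M → ∃ K : Submodule Λ M, IsCoatom K := by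
  refine IsSemiprimaryRing.induction Λ Λ M
    (P := fun M _ _ _ => Nontrivial M → ∃ K : Submodule Λ M, IsCoatom K) ?_ ?_
  · intro M _ _ _ _ _ _ hM
    rcases IsCoatomic.eq_top_or_exists_le_coatom (⊥ : Submodule Λ M) with h | ⟨K, hK, _⟩
    · exact absurd h bot_ne_top
    · exact ⟨K, hK⟩
  · intro M _ _ _ _ N hN hQ hM
    by_cases h : N = ⊤
    · have hNn : Nontrivial N := by
        rw [h]; exact (Submodule.topEquiv (R := Λ) (M := M)).toEquiv.nontrivial
      obtain ⟨K, hK⟩ := hN hNn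
      have e : N ≃ₗ[Λ] M := (LinearEquiv.ofEq _ _ h).trans Submodule.topEquiv
      exact ⟨Submodule.orderIsoMapComap e K, (OrderIso.isCoatom_iff _ _).2 hK⟩
    · have : Nontrivial (M ⧸ N) := Submodule.Quotient.nontrivial_iff.2 h
      obtain ⟨K, hK⟩ := hQ this
      have : IsSimpleModule Λ ((M ⧸ N) ⧸ K) := isSimpleModule_iff_isCoatom.2 hK
      refine ⟨LinearMap.ker (K.mkQ ∘ₗ N.mkQ), LinearMap.isCoatom_ker_of_surjective ?_⟩
      exact (K.mkQ_surjective).comp N.mkQ_surjective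

theorem exists_le_coatom [IsArtinianRing Λ] (N : Submodule Λ M) (h : N ≠ ⊤) :
    ∃ K, IsCoatom K ∧ N ≤ K := by
  obtain ⟨K, hK⟩ := exists_coatom_of_nontrivial (Λ := Λ) (M ⧸ N)
    (Submodule.Quotient.nontrivial_iff.2 h)
  have : IsSimpleModule Λ ((M ⧸ N) ⧸ K) := isSimpleModule_iff_isCoatom.2 hK
  refine ⟨LinearMap.ker (K.mkQ ∘ₗ N.mkQ), LinearMap.isCoatom_ker_of_surjective ?_, ?_⟩
  · exact (K.mkQ_surjective).comp N.mkQ_surjective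
  · intro x hx
    rw [LinearMap.mem_ker, LinearMap.comp_apply, (Submodule.Quotient.mk_eq_zero N).2 hx |> fun h => (h : N.mkQ x = 0), map_zero]

/-- A nonzero module has a simple quotient. -/
theorem exists_simple_quot [IsArtinianRing Λ] (M : Type u) [AddCommGroup M] [Module Λ M]
    [Nontrivial M] : ∃ K : Submodule Λ M, IsSimpleModule Λ (M ⧸ K) := by
  obtain ⟨K, hK⟩ := exists_coatom_of_nontrivial (Λ := Λ) M inferInstance
  exact ⟨K, isSimpleModule_iff_isCoatom.2 hK⟩

/-- `f` is a surjection whose kernel contains every proper submodule. -/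
def LocalCov (f : M →ₗ[Λ] X) : Prop :=
  Function.Surjective f ∧ ∀ K : Submodule Λ M, K ≠ ⊤ → K ≤ LinearMap.ker f

theorem le_of_superfluous [IsArtinianRing Λ] {p : M →ₗ[Λ] X}
    (hp : LinearMap.ker p ≤ modRadical Λ M) (K : Submodule Λ M) (h : K ⊔ LinearMap.ker p = ⊤) :
    K = ⊤ := by
  by_contra hK
  obtain ⟨C, hC, hKC⟩ := exists_le_coatom K hK
  have h1 : LinearMap.ker p ≤ C := hp.trans (sInf_le hC)
  exact hC.1 (top_le_iff.1 (h ▸ sup_le hKC h1))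

theorem surj_of_comp_surj [IsArtinianRing Λ] {p : M →ₗ[Λ] X}
    (hp : LinearMap.ker p ≤ modRadical Λ M) (φ : N →ₗ[Λ] M) (h : Function.Surjective (p ∘ₗ φ)) :
    Function.Surjective φ := by
  rw [← LinearMap.range_eq_top]
  refine le_of_superfluous hp _ (top_le_iff.1 fun x _ => ?_)
  obtain ⟨y, hy⟩ := h (p x)
  rw [Submodule.mem_sup]
  exact ⟨φ y, ⟨y, rfl⟩, x - φ y, by simpa [sub_eq_zero] using hy.symm, by abel⟩

theorem cover_unique [IsArtinianRing Λ] {p : M →ₗ[Λ] X} {q : N →ₗ[Λ] X}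
    (hp : IsProjCover p) (hq : IsProjCover q) : ∃ e : M ≃ₗ[Λ] N, q ∘ₗ e.toLinearMap = p := by
  have := hp.projective
  have := hq.projective
  obtain ⟨φ, hφ⟩ := Module.projective_lifting_property q p hq.surjective
  have hφs : Function.Surjective φ := surj_of_comp_surj hq.superfluous φ (hφ ▸ hp.surjective)
  obtain ⟨σ, hσ⟩ := Module.projective_lifting_property φ LinearMap.id hφs
  have h1 : p ∘ₗ σ = q := by
    rw [← hφ, LinearMap.comp_assoc, hσ, LinearMap.comp_id]
  have hσs : Function.Surjective σ := surj_of_comp_surj hp.superfluous σ (h1 ▸ hq.surjective)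
  have hinj : Function.Injective φ := by
    intro a b hab
    obtain ⟨a, rfl⟩ := hσs a
    obtain ⟨b, rfl⟩ := hσs b
    have ha : φ (σ a) = a := LinearMap.congr_fun hσ a
    have hb : φ (σ b) = b := LinearMap.congr_fun hσ b
    rw [← ha, ← hb, hab]
  exact ⟨LinearEquiv.ofBijective φ ⟨hinj, hφs⟩, by ext x; exact LinearMap.congr_fun hφ x⟩

theorem localCov_of_ker_le [IsArtinianRing Λ] [IsSimpleModule Λ X] {p : M →ₗ[Λ] X}
    (hs : Function.Surjective p) (hp : LinearMap.ker p ≤ modRadical Λ M) : LocalCov p := by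
  refine ⟨hs, fun K hK => ?_⟩
  obtain ⟨C, hC, hKC⟩ := exists_le_coatom K hK
  have h1 : LinearMap.ker p ≤ C := hp.trans (sInf_le hC)
  have h2 := LinearMap.isCoatom_ker_of_surjective hs
  rcases h2.le_iff.1 h1 with h | h
  · exact absurd h hC.1
  · exact h ▸ hKC


theorem LocalCov.surj {f : M →ₗ[Λ] X} (hf : LocalCov f) [Nontrivial X] (φ : N →ₗ[Λ] M)
    (h : f ∘ₗ φ ≠ 0) : Function.Surjective φ := by
  rw [← LinearMap.range_eq_top]
  by_contra hr
  apply h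
  ext x
  exact hf.2 _ hr ⟨x, rfl⟩

theorem LocalCov.indec {f : M →ₗ[Λ] X} (hf : LocalCov f) [Nontrivial X] :
    IsIndecomposableMod Λ M := by
  refine ⟨hf.1.nontrivial, fun A B hAB => ?_⟩
  by_contra! h
  have hA : A ≠ ⊤ := fun hA => h.2 (by simpa [hA] using hAB.inf_eq_bot)
  have hB : B ≠ ⊤ := fun hB => h.1 (by simpa [hB] using hAB.inf_eq_bot)
  have h1 : LinearMap.ker f = ⊤ := top_le_iff.1 (hAB.sup_eq_top ▸ sup_le (hf.2 A hA) (hf.2 B hB))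
  obtain ⟨x, hx⟩ := exists_ne (0 : X)
  obtain ⟨y, rfl⟩ := hf.1 x
  exact hx (LinearMap.mem_ker.1 (h1 ▸ Submodule.mem_top))

/-- any simple quotient is isomorphic to the top -/
theorem LocalCov.top_iso {f : M →ₗ[Λ] X} (hf : LocalCov f) [IsSimpleModule Λ X]
    [IsSimpleModule Λ Y] (h : M →ₗ[Λ] Y) (hh : Function.Surjective h) : Nonempty (X ≃ₗ[Λ] Y) := by
  have h1 := LinearMap.isCoatom_ker_of_surjective hh
  have h2 := LinearMap.isCoatom_ker_of_surjective hf.1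
  have h3 : LinearMap.ker h = LinearMap.ker f :=
    (h1.le_iff.1 (hf.2 _ h1.1)).resolve_left h2.1 |>.symm
  exact ⟨(f.quotKerEquivOfSurjective hf.1).symm.trans
    ((Submodule.quotEquivOfEq _ _ h3.symm).trans (h.quotKerEquivOfSurjective hh))⟩

theorem length_of_hasLength {n : ℕ} (h : HasLength Λ M n) : Module.length Λ M = n := by
  obtain ⟨c, h0, h1, h2⟩ := h
  exact (Module.length_compositionSeries (R := Λ) (M := M)
    ⟨n, c, fun i => h2 i⟩ h0 h1).symm

theorem hasLength_of_finite [IsNoetherian Λ M] [IsArtinian Λ M] : ∃ n, HasLength Λ M n := by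
  obtain ⟨s, h0, h1⟩ := exists_compositionSeries_of_isNoetherian_isArtinian Λ M
  exact ⟨s.length, s.toFun, h0, h1, fun i => s.step i⟩

theorem finite_of_hasLength {n : ℕ} (h : HasLength Λ M n) : IsNoetherian Λ M ∧ IsArtinian Λ M := by
  rw [← isFiniteLength_iff_isNoetherian_isArtinian, ← Module.length_ne_top_iff,
    length_of_hasLength h]
  exact ENat.natCast_ne_top n

theorem length_ker_range (φ : M →ₗ[Λ] N) :
    Module.length Λ M = Module.length Λ (LinearMap.ker φ) + Module.length Λ (LinearMap.range φ) :=
  Module.length_eq_add_of_exact (LinearMap.ker φ).subtype φ.rangeRestrict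
    (Submodule.subtype_injective _) φ.surjective_rangeRestrict
    (by intro x; simp [LinearMap.rangeRestrict, Subtype.ext_iff])

theorem length_ker_surj (φ : M →ₗ[Λ] N) (h : Function.Surjective φ) :
    Module.length Λ M = Module.length Λ (LinearMap.ker φ) + Module.length Λ N :=
  Module.length_eq_add_of_exact (LinearMap.ker φ).subtype φ
    (Submodule.subtype_injective _) h (LinearMap.exact_subtype_ker_map φ)

theorem eq_of_length [IsNoetherian Λ M] [IsArtinian Λ M] {A B : Submodule Λ M} (hAB : A ≤ B)
    (h : Module.length Λ A = Module.length Λ B) : A = B := by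
  by_contra hne
  have h1 : Order.height A < Order.height B := Submodule.height_strictMono (lt_of_le_of_ne hAB hne)
  rw [← Module.length_submodule, ← Module.length_submodule, h] at h1
  exact lt_irrefl _ h1

theorem eq_of_length_uniserial [IsNoetherian Λ M] [IsArtinian Λ M] (hu : IsUniserialMod Λ M)
    {A B : Submodule Λ M} (h : Module.length Λ A = Module.length Λ B) : A = B := by
  rcases hu A B with h1 | h1
  · exact eq_of_length h1 h
  · exact (eq_of_length h1 h.symm).symm

/-- Two surjections of the same length from a uniserial module have isomorphic images. -/
theorem quot_iso_of_length [IsNoetherian Λ M] [IsArtinian Λ M] (hu : IsUniserialMod Λ M)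
    (f : M →ₗ[Λ] X) (g : M →ₗ[Λ] Y) (hf : Function.Surjective f) (hg : Function.Surjective g)
    (h : Module.length Λ X = Module.length Λ Y) : Nonempty (X ≃ₗ[Λ] Y) := by
  have h1 := length_ker_surj f hf
  have h2 := length_ker_surj g hg
  have h3 : Module.length Λ M ≠ ⊤ := Module.length_ne_top
  have h4 : LinearMap.ker f = LinearMap.ker g := by
    apply eq_of_length_uniserial hu
    rw [← h, h1] at h2
    rw [h1] at h3
    exact WithTop.add_right_cancel (fun h => h3 ((congrArg _ h).trans (add_top _))) h2
  exact ⟨(f.quotKerEquivOfSurjective hf).symm.trans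
    ((Submodule.quotEquivOfEq _ _ h4).trans (g.quotKerEquivOfSurjective hg))⟩

theorem uniserial_congr (e : M ≃ₗ[Λ] N) (h : IsUniserialMod Λ M) : IsUniserialMod Λ N := by
  intro A B
  have := h (A.comap e.toLinearMap) (B.comap e.toLinearMap)
  rcases this with h | h
  · exact Or.inl ((Submodule.comap_le_comap_iff_of_surjective e.surjective).1 h)
  · exact Or.inr ((Submodule.comap_le_comap_iff_of_surjective e.surjective).1 h)

end General
section Inj

variable {Λ}
variable {A B X Y Z : Type u} [AddCommGroup A] [Module Λ A] [AddCommGroup B] [Module Λ B]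
  [AddCommGroup X] [Module Λ X] [AddCommGroup Y] [Module Λ Y] [AddCommGroup Z] [Module Λ Z]

theorem exists_separating [IsSimpleModule Λ X] [IsSimpleModule Λ Y]
    (hne : ¬ Nonempty (X ≃ₗ[Λ] Y)) (x : X) (y : Y) (hx : x ≠ 0) :
    ∃ l : Λ, l • x ≠ 0 ∧ l • y = 0 := by
  by_cases hy : y = 0
  · exact ⟨1, by simpa using hx, by simp [hy]⟩
  by_contra! hcon
  apply hne
  have hxs : Function.Surjective (LinearMap.toSpanSingleton Λ X x) :=
    LinearMap.surjective_of_ne_zero fun h => hx (by simpa using LinearMap.congr_fun h 1)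
  have hys : Function.Surjective (LinearMap.toSpanSingleton Λ Y y) :=
    LinearMap.surjective_of_ne_zero fun h => hy (by simpa using LinearMap.congr_fun h 1)
  have h1 := LinearMap.isCoatom_ker_of_surjective hxs
  have h2 := LinearMap.isCoatom_ker_of_surjective hys
  have hle : LinearMap.ker (LinearMap.toSpanSingleton Λ Y y) ≤
      LinearMap.ker (LinearMap.toSpanSingleton Λ X x) := by
    intro l hl
    by_contra hl2
    exact hcon l (by simpa using hl2) (by simpa using hl)
  have h3 := (h2.le_iff.1 hle).resolve_left h1.1
  exact ⟨(LinearMap.quotKerEquivOfSurjective _ hxs).symm.trans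
    ((Submodule.quotEquivOfEq _ _ h3).trans (LinearMap.quotKerEquivOfSurjective _ hys))⟩

theorem inj_core [IsSimpleModule Λ X] [IsSimpleModule Λ Y] [IsSimpleModule Λ Z]
    (hne : ¬ Nonempty (X ≃ₗ[Λ] Y)) {f : A →ₗ[Λ] X} (hf : LocalCov f) (g : B →ₗ[Λ] Y)
    (α : LinearMap.ker f →ₗ[Λ] Z) (hα : Function.Surjective α)
    (β : LinearMap.ker g →ₗ[Λ] Z) (N : Submodule Λ (A × B))
    (hD : ∀ (a : LinearMap.ker f) (b : LinearMap.ker g), α a + β b = 0 → ((a : A), (b : B)) ∈ N)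
    (u : A) (v : B) (huv : (u, v) ∈ N) (hu : f u ≠ 0) :
    ∃ a : LinearMap.ker f, α a ≠ 0 ∧ ((a : A), (0 : B)) ∈ N := by
  obtain ⟨l, hl1, hl2⟩ := exists_separating hne (f u) (g v) hu
  rw [← map_smul] at hl1 hl2
  obtain ⟨z, hz⟩ := hα (- β ⟨l • v, hl2⟩)
  have h1 := hD z ⟨l • v, hl2⟩ (by rw [hz]; simp)
  have h2 : (l • u - (z : A), (0 : B)) ∈ N := by
    have := N.sub_mem (N.smul_mem l huv) h1
    simpa using this
  have h3 : f (l • u - (z : A)) ≠ 0 := by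
    rw [map_sub, LinearMap.mem_ker.1 z.2, sub_zero]; exact hl1
  have h4 : Submodule.span Λ {l • u - (z : A)} = ⊤ := by
    by_contra h
    exact h3 (hf.2 _ h (Submodule.mem_span_singleton_self _))
  have := IsSimpleModule.nontrivial Λ Z
  obtain ⟨w, hw⟩ := exists_ne (0 : Z)
  obtain ⟨a, rfl⟩ := hα w
  refine ⟨a, hw, ?_⟩
  have h5 : (a : A) ∈ Submodule.span Λ {l • u - (z : A)} := h4 ▸ Submodule.mem_top
  obtain ⟨m, hm⟩ := Submodule.mem_span_singleton.1 h5
  have := N.smul_mem m h2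
  rw [← hm]
  simpa using this

theorem top_unique [IsNakayama Λ] [IsNoetherian Λ A] [IsArtinian Λ A] [IsNoetherian Λ B]
    [IsArtinian Λ B] [IsSimpleModule Λ X] [IsSimpleModule Λ Y] [IsSimpleModule Λ Z]
    {f : A →ₗ[Λ] X} (hf : LocalCov f) {g : B →ₗ[Λ] Y} (hg : LocalCov g)
    (α : LinearMap.ker f →ₗ[Λ] Z) (hα : Function.Surjective α)
    (β : LinearMap.ker g →ₗ[Λ] Z) (hβ : Function.Surjective β) : Nonempty (X ≃ₗ[Λ] Y) := by
  by_contra hne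
  have hne2 : ¬ Nonempty (Y ≃ₗ[Λ] X) := fun ⟨e⟩ => hne ⟨e.symm⟩
  have hZ := IsSimpleModule.nontrivial Λ Z
  have hX := IsSimpleModule.nontrivial Λ X
  have hY := IsSimpleModule.nontrivial Λ Y
  let D : Submodule Λ (A × B) := (LinearMap.ker (α.coprod β)).map
    (LinearMap.prodMap (LinearMap.ker f).subtype (LinearMap.ker g).subtype)
  have memD : ∀ (a : LinearMap.ker f) (b : LinearMap.ker g), ((a : A), (b : B)) ∈ D ↔
      α a + β b = 0 := by
    intro a b
    constructor
    · rintro ⟨⟨a', b'⟩, h1, h2⟩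
      simp only [LinearMap.prodMap_apply, Submodule.subtype_apply, Prod.mk.injEq,
        Subtype.coe_inj] at h2
      obtain ⟨rfl, rfl⟩ := h2
      simpa using h1
    · intro h
      exact ⟨(a, b), by simpa using h, rfl⟩
  have Dle : ∀ x ∈ D, f x.1 = 0 ∧ g x.2 = 0 := by
    rintro x ⟨⟨a, b⟩, _, rfl⟩
    exact ⟨a.2, b.2⟩
  -- every submodule strictly above `D` contains `ker f × ker g`
  have big1 : ∀ N : Submodule Λ (A × B), D ≤ N →
      (∃ (a : LinearMap.ker f) (b : LinearMap.ker g), ((a : A), (b : B)) ∈ N ∧ α a + β b ≠ 0) →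
      ∀ (a : LinearMap.ker f) (b : LinearMap.ker g), ((a : A), (b : B)) ∈ N := by
    rintro N hDN ⟨a, b, hab, hne⟩ a' b'
    obtain ⟨l, hl⟩ := IsSimpleModule.toSpanSingleton_surjective Λ hne (α a' + β b')
    rw [LinearMap.toSpanSingleton_apply] at hl
    have h1 : (((a' - l • a : LinearMap.ker f) : A), ((b' - l • b : LinearMap.ker g) : B)) ∈ N := by
      apply hDN
      rw [memD, map_sub, map_sub, map_smul, map_smul, sub_add_sub_comm, ← smul_add, hl, sub_self]
    have := N.add_mem h1 (N.smul_mem l hab)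
    simpa using this
  have big : ∀ N : Submodule Λ (A × B), D ≤ N → ¬ N ≤ D →
      ∀ (a : LinearMap.ker f) (b : LinearMap.ker g), ((a : A), (b : B)) ∈ N := by
    intro N hDN hND
    apply big1 N hDN
    obtain ⟨⟨u, v⟩, hN, hnD⟩ := SetLike.not_le_iff_exists.1 hND
    by_cases hu : f u = 0
    · by_cases hv : g v = 0
      · exact ⟨⟨u, hu⟩, ⟨v, hv⟩, hN, fun h => hnD ((memD ⟨u, hu⟩ ⟨v, hv⟩).2 h)⟩
      · obtain ⟨b, hb, hbN⟩ := inj_core hne2 hg f β hβ α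
          (N.comap (LinearEquiv.prodComm Λ B A).toLinearMap)
          (fun b a h => hDN ((memD a b).2 (by rw [add_comm]; exact h))) v u hN hv
        exact ⟨0, b, hbN, by simpa using hb⟩
    · obtain ⟨a, ha, haN⟩ := inj_core hne hf g α hα β N
          (fun a b h => hDN ((memD a b).2 h)) u v hN hu
      exact ⟨a, 0, haN, by simpa using ha⟩
  obtain ⟨w, hw⟩ := exists_ne (0 : Z)
  obtain ⟨a0, ha0⟩ := hα w
  have ha0D : ((a0 : A), (0 : B)) ∉ D := by
    intro h
    apply hw
    have := (memD a0 0).1 h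
    simpa [ha0] using this
  have hDtop : D ≠ ⊤ := fun h => ha0D (h ▸ Submodule.mem_top)
  have hind : IsIndecomposableMod Λ ((A × B) ⧸ D) := by
    refine ⟨Submodule.Quotient.nontrivial_iff.2 hDtop, fun N N' hNN => ?_⟩
    by_contra! hcon
    have key : ∀ K : Submodule Λ ((A × B) ⧸ D), K ≠ ⊥ → D.mkQ ((a0 : A), (0 : B)) ∈ K := by
      intro K hK
      refine big (K.comap D.mkQ) (Submodule.le_comap_mkQ D K) (fun hle => hK ?_) a0 0
      rw [eq_bot_iff]
      intro x hx
      obtain ⟨x, rfl⟩ := D.mkQ_surjective x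
      exact (Submodule.Quotient.mk_eq_zero D).2 (hle hx)
    have : D.mkQ ((a0 : A), (0 : B)) ∈ N ⊓ N' := ⟨key N hcon.1, key N' hcon.2⟩
    rw [hNN.inf_eq_bot] at this
    exact ha0D ((Submodule.Quotient.mk_eq_zero D).1 this)
  have huni : IsUniserialMod Λ ((A × B) ⧸ D) := IsNakayama.serial _ hasLength_of_finite hind
  have hfin : ∀ (a : A) (b : B), f a ≠ 0 → D.mkQ (a, 0) ∈
      LinearMap.range (D.mkQ ∘ₗ LinearMap.inr Λ A B) → False := by
    rintro a b ha ⟨b', hb'⟩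
    have h1 : D.mkQ ((0 : A), b') = D.mkQ (a, (0 : B)) := hb'
    have h2 := (Submodule.Quotient.eq D).1 h1
    have h3 := (Dle _ h2).1
    simp at h3
    exact ha h3
  have hfin2 : ∀ (b : B), g b ≠ 0 → D.mkQ (0, b) ∈
      LinearMap.range (D.mkQ ∘ₗ LinearMap.inl Λ A B) → False := by
    rintro b hb ⟨a', ha'⟩
    have h1 : D.mkQ (a', (0 : B)) = D.mkQ ((0 : A), b) := ha'
    have h2 := (Submodule.Quotient.eq D).1 h1
    have h3 := (Dle _ h2).2
    simp at h3
    exact hb h3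
  obtain ⟨x, hx⟩ := exists_ne (0 : X)
  obtain ⟨a, rfl⟩ := hf.1 x
  obtain ⟨y, hy⟩ := exists_ne (0 : Y)
  obtain ⟨b, rfl⟩ := hg.1 y
  rcases huni (LinearMap.range (D.mkQ ∘ₗ LinearMap.inl Λ A B))
    (LinearMap.range (D.mkQ ∘ₗ LinearMap.inr Λ A B)) with h | h
  · exact hfin a 0 hx (h ⟨a, rfl⟩)
  · exact hfin2 b hy (h ⟨b, rfl⟩)

end Inj

section Exist

variable {Λ}

theorem exists_cover [IsNakayama Λ] (X : Type u) [AddCommGroup X] [Module Λ X]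
    [IsSimpleModule Λ X] :
    ∃ (L : Submodule Λ Λ) (f : L →ₗ[Λ] X), Module.Projective Λ L ∧ LocalCov f ∧
      IsUniserialMod Λ L := by
  have hart : IsArtinianRing Λ := IsNakayama.artinian
  let Q : Set (Submodule Λ Λ) := {L | ∃ r : Λ →ₗ[Λ] L, (∀ x : L, r x = x) ∧ ∃ f : L →ₗ[Λ] X, f ≠ 0}
  have hQ : Q.Nonempty := by
    have := IsSimpleModule.nontrivial Λ X
    obtain ⟨x, hx⟩ := exists_ne (0 : X)
    refine ⟨⊤, Submodule.topEquiv.symm.toLinearMap, fun x => by ext; rfl,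
      (LinearMap.toSpanSingleton Λ X x) ∘ₗ (⊤ : Submodule Λ Λ).subtype, fun h => hx ?_⟩
    simpa using LinearMap.congr_fun h ⟨1, Submodule.mem_top⟩
  obtain ⟨L, ⟨r, hr, f, hf⟩, hmin⟩ := (wellFounded_lt (α := Submodule Λ Λ)).has_min Q hQ
  have hsummand : ∀ A B : Submodule Λ L, IsCompl A B → f ∘ₗ A.subtype ≠ 0 → B = ⊥ := by
    intro A B hAB hA
    let e : A ≃ₗ[Λ] A.map L.subtype :=
      Submodule.equivMapOfInjective L.subtype L.subtype_injective A
    have hmem : A.map L.subtype ∈ Q := by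
      refine ⟨e.toLinearMap ∘ₗ (Submodule.projectionOnto A B hAB) ∘ₗ r, ?_,
        (f ∘ₗ A.subtype) ∘ₗ e.symm.toLinearMap, ?_⟩
      · rintro x
        obtain ⟨a, rfl⟩ := e.surjective x
        have h1 : ((e a : A.map L.subtype) : Λ) = ((a : L) : Λ) := rfl
        simp only [LinearMap.comp_apply, h1, hr]
        simp
      · intro h
        apply hA
        ext a
        simpa using LinearMap.congr_fun h (e a)
    have hle : A.map L.subtype ≤ L := Submodule.map_subtype_le L A
    have heq : A.map L.subtype = L := by
      by_contra hne
      exact hmin _ hmem (lt_of_le_of_ne hle hne)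
    have hA : A = ⊤ := by
      rw [eq_top_iff]
      intro x _
      have : (x : Λ) ∈ A.map L.subtype := by rw [heq]; exact x.2
      obtain ⟨y, hy, hxy⟩ := this
      have : y = x := Subtype.ext hxy
      exact this ▸ hy
    simpa [hA] using hAB.inf_eq_bot
  have hind : IsIndecomposableMod Λ L := by
    constructor
    · by_contra h
      rw [not_nontrivial_iff_subsingleton] at h
      exact hf (LinearMap.ext fun x => by rw [Subsingleton.elim x 0]; simp)
    · intro A B hAB
      by_cases hA : f ∘ₗ A.subtype = 0
      · by_cases hB : f ∘ₗ B.subtype = 0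
        · exfalso
          apply hf
          have h1 : A ≤ LinearMap.ker f := fun x hx => LinearMap.congr_fun hA ⟨x, hx⟩
          have h2 : B ≤ LinearMap.ker f := fun x hx => LinearMap.congr_fun hB ⟨x, hx⟩
          rw [← LinearMap.ker_eq_top, ← top_le_iff, ← hAB.sup_eq_top]
          exact sup_le h1 h2
        · exact Or.inl (hsummand B A hAB.symm hB)
      · exact Or.inr (hsummand A B hAB hA)
  have huni : IsUniserialMod Λ L := IsNakayama.serial _ hasLength_of_finite hind
  have hsurj := LinearMap.surjective_of_ne_zero hf
  refine ⟨L, f, Module.Projective.of_split L.subtype r (LinearMap.ext hr), ⟨hsurj, ?_⟩, huni⟩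
  intro K hK
  rcases huni K (LinearMap.ker f) with h | h
  · exact h
  · rcases (LinearMap.isCoatom_ker_of_surjective hsurj).le_iff.1 h with h | h
    · exact absurd h hK
    · exact h.le

end Exist

section Conn

variable {Λ}

/-- The trace in `Λ` of a family of modules. -/
def trc {ι : Type} (L : ι → Submodule Λ Λ) (O : Set ι) : Submodule Λ Λ :=
  ⨆ p : (Σ i : O, (L i →ₗ[Λ] Λ)), LinearMap.range p.2

theorem range_le_trc {ι : Type} (L : ι → Submodule Λ Λ) (O : Set ι) {i : ι} (hi : i ∈ O)
    (φ : L i →ₗ[Λ] Λ) : LinearMap.range φ ≤ trc L O :=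
  le_iSup (fun p : (Σ i : O, (L i →ₗ[Λ] Λ)) => LinearMap.range p.2) ⟨⟨i, hi⟩, φ⟩

theorem trc_mul {ι : Type} (L : ι → Submodule Λ Λ) (O : Set ι) (a x : Λ) (ha : a ∈ trc L O) :
    a * x ∈ trc L O := by
  have h : (trc L O).map (LinearMap.toSpanSingleton Λ Λ x) ≤ trc L O := by
    conv_lhs => rw [trc]
    rw [Submodule.map_iSup]
    refine iSup_le fun p => ?_
    rw [← LinearMap.range_comp]
    exact range_le_trc L O p.1.2 _
  exact h ⟨a, ha, rfl⟩

theorem trc_orth {ι : Type} (L : ι → Submodule Λ Λ) (hproj : ∀ i, Module.Projective Λ (L i))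
    (O : Set ι) (j : ι) (hj : ∀ i ∈ O, ∀ φ : L j →ₗ[Λ] L i, φ = 0)
    (φ : L j →ₗ[Λ] Λ) (hφ : LinearMap.range φ ≤ trc L O) : φ = 0 := by
  classical
  have := hproj j
  let p : (Σ i : O, (L i →ₗ[Λ] Λ)) → Submodule Λ Λ := fun p => LinearMap.range p.2
  have hzero : ∀ k, ∀ ψ : L j →ₗ[Λ] p k, ψ = 0 := by
    intro k ψ
    obtain ⟨χ, hχ⟩ := Module.projective_lifting_property k.2.rangeRestrict ψ
      k.2.surjective_rangeRestrict
    rw [← hχ, hj k.1 k.1.2 χ, LinearMap.comp_zero]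
  let s : (Π₀ k, p k) →ₗ[Λ] Λ := DFinsupp.lsum ℕ fun k => (p k).subtype
  have hs : LinearMap.range s = trc L O := (Submodule.iSup_eq_range_dfinsupp_lsum p).symm
  obtain ⟨χ, hχ⟩ := Module.projective_lifting_property s.rangeRestrict
    (φ.codRestrict (LinearMap.range s) (fun x => hs ▸ hφ ⟨x, rfl⟩)) s.surjective_rangeRestrict
  have hχ0 : χ = 0 := by
    ext x : 1
    refine DFinsupp.ext fun k => ?_
    have := hzero k ((DFinsupp.lapply k) ∘ₗ χ)
    exact LinearMap.congr_fun this x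
  ext x
  have := congrArg Subtype.val (LinearMap.congr_fun hχ x)
  rw [hχ0] at this
  simpa using this.symm

theorem connected_all [IsArtinianRing Λ] (hconn : IsConnectedAlg Λ) {ι : Type}
    (L : ι → Submodule Λ Λ) (hproj : ∀ i, Module.Projective Λ (L i)) (hL : ∀ i, L i ≠ ⊥)
    (hgen : ∀ (M : Type u) [AddCommGroup M] [Module Λ M], Nontrivial M →
      ∃ i, ∃ φ : L i →ₗ[Λ] M, φ ≠ 0)
    (O : Set ι) (hO : O.Nonempty)
    (h1 : ∀ i ∈ O, ∀ j ∉ O, ∀ φ : L j →ₗ[Λ] L i, φ = 0)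
    (h2 : ∀ i ∈ O, ∀ j ∉ O, ∀ φ : L i →ₗ[Λ] L j, φ = 0) (j : ι) : j ∈ O := by
  have hsup : trc L O ⊔ trc L Oᶜ = ⊤ := by
    by_contra hne
    obtain ⟨i, φ, hφ⟩ := hgen (Λ ⧸ (trc L O ⊔ trc L Oᶜ)) (Submodule.Quotient.nontrivial_iff.2 hne)
    have := hproj i
    obtain ⟨ψ, hψ⟩ := Module.projective_lifting_property (Submodule.mkQ _) φ
      (Submodule.mkQ_surjective _)
    have h3 : LinearMap.range ψ ≤ trc L O ⊔ trc L Oᶜ := by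
      by_cases hi : i ∈ O
      · exact (range_le_trc L O hi ψ).trans le_sup_left
      · exact (range_le_trc L Oᶜ hi ψ).trans le_sup_right
    apply hφ
    rw [← hψ]
    ext x
    exact (Submodule.Quotient.mk_eq_zero _).2 (h3 ⟨x, rfl⟩)
  have hinf : trc L O ⊓ trc L Oᶜ = ⊥ := by
    by_contra hne
    obtain ⟨i, φ, hφ⟩ := hgen (trc L O ⊓ trc L Oᶜ : Submodule Λ Λ)
      (Submodule.nontrivial_iff_ne_bot.2 hne)
    apply hφ
    have h0 : (Submodule.subtype _) ∘ₗ φ = 0 := by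
      by_cases hi : i ∈ O
      · refine trc_orth L hproj Oᶜ i (fun k hk => h2 i hi k hk) _ ?_
        rintro _ ⟨x, rfl⟩
        exact (φ x).2.2
      · refine trc_orth L hproj O i (fun k hk => h1 k hk i hi) _ ?_
        rintro _ ⟨x, rfl⟩
        exact (φ x).2.1
    ext x
    simpa using LinearMap.congr_fun h0 x
  have hmem0 : ∀ x, x ∈ trc L O → x ∈ trc L Oᶜ → x = 0 := fun x ha hb => by
    have : x ∈ trc L O ⊓ trc L Oᶜ := ⟨ha, hb⟩
    rw [hinf] at this
    simpa using this
  have hle : ∀ (O' : Set ι) (i : ι), i ∈ O' → L i ≤ trc L O' := fun O' i hi => by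
    simpa using range_le_trc L O' hi (L i).subtype
  obtain ⟨e, he, f, hf, hef⟩ := Submodule.mem_sup.1 (hsup ▸ Submodule.mem_top : (1 : Λ) ∈ _)
  have hf' : f = 1 - e := by rw [← hef]; abel
  have hcen : ∀ x : Λ, e * x = x * e := by
    intro x
    rw [← sub_eq_zero]
    apply hmem0
    · exact Submodule.sub_mem _ (trc_mul L O e x he) (Submodule.smul_mem _ x he)
    · have : e * x - x * e = x * f - f * x := by rw [hf']; noncomm_ring
      rw [this]
      exact Submodule.sub_mem _ (Submodule.smul_mem _ x hf) (trc_mul L Oᶜ f x hf)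
  have hid : IsIdempotentElem e := by
    have : e - e * e = 0 := by
      apply hmem0
      · exact Submodule.sub_mem _ he (trc_mul L O e e he)
      · have : e - e * e = e * f := by rw [hf']; noncomm_ring
        rw [this]
        exact Submodule.smul_mem _ e hf
    exact (sub_eq_zero.1 this).symm
  have hO' : ∀ x : Λ, x ∈ trc L O → x * e = x := by
    intro x hx
    have : x * f = 0 := hmem0 _ (trc_mul L O x f hx) (Submodule.smul_mem _ x hf)
    rw [hf', mul_sub, mul_one, sub_eq_zero] at this
    exact this.symm
  have hOc : ∀ x : Λ, x ∈ trc L Oᶜ → x * e = 0 := by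
    intro x hx
    exact hmem0 _ (Submodule.smul_mem _ x he) (trc_mul L Oᶜ x e hx)
  rcases hconn e hid hcen with h | h
  · obtain ⟨i, hi⟩ := hO
    exfalso
    apply hL i
    rw [eq_bot_iff]
    intro x hx
    have := hO' x (hle O i hi hx)
    rw [h, mul_zero] at this
    exact this.symm
  · by_contra hj
    apply hL j
    rw [eq_bot_iff]
    intro x hx
    have := hOc x (hle Oᶜ j hj hx)
    rw [h, mul_one] at this
    exact this

end Conn
section Main

variable {Λ}
variable {M N X Y : Type u} [AddCommGroup M] [Module Λ M] [AddCommGroup N] [Module Λ N]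
  [AddCommGroup X] [Module Λ X] [AddCommGroup Y] [Module Λ Y]

theorem localCov_of_uniserial [IsSimpleModule Λ X] (hu : IsUniserialMod Λ M) (f : M →ₗ[Λ] X)
    (hf : Function.Surjective f) : LocalCov f := by
  refine ⟨hf, fun K hK => ?_⟩
  rcases hu K (LinearMap.ker f) with h | h
  · exact h
  · rcases (LinearMap.isCoatom_ker_of_surjective hf).le_iff.1 h with h | h
    · exact absurd h hK
    · exact h.le

theorem uniserial_sub (hu : IsUniserialMod Λ M) (K : Submodule Λ M) : IsUniserialMod Λ K := by
  intro A B
  have h := hu (A.map K.subtype) (B.map K.subtype)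
  rwa [Submodule.map_le_map_iff_of_injective K.subtype_injective,
    Submodule.map_le_map_iff_of_injective K.subtype_injective] at h

theorem LocalCov.ker_le_rad [IsSimpleModule Λ X] {f : M →ₗ[Λ] X} (hf : LocalCov f) :
    LinearMap.ker f ≤ modRadical Λ M := by
  refine le_sInf fun K hK => ?_
  have h1 := LinearMap.isCoatom_ker_of_surjective hf.1
  rcases hK.le_iff.1 (hf.2 K hK.1) with h | h
  · exact absurd h h1.1
  · exact h.le

/-- Any surjection from a projective local module to a nonzero module is a projective cover. -/
theorem LocalCov.isProjCover [IsSimpleModule Λ X] {f : M →ₗ[Λ] X} (hf : LocalCov f)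
    (hproj : Module.Projective Λ M) [Nontrivial Y] (q : M →ₗ[Λ] Y) (hq : Function.Surjective q) :
    IsProjCover q := by
  refine ⟨hproj, hq, (hf.2 _ fun h => ?_).trans hf.ker_le_rad⟩
  obtain ⟨y, hy⟩ := exists_ne (0 : Y)
  obtain ⟨x, rfl⟩ := hq y
  exact hy (LinearMap.mem_ker.1 (h ▸ Submodule.mem_top))

theorem LocalCov.comp_equiv {f : M →ₗ[Λ] X} (hf : LocalCov f) (e : X ≃ₗ[Λ] Y) :
    LocalCov (e.toLinearMap ∘ₗ f) := by
  refine ⟨e.surjective.comp hf.1, fun K hK x hx => ?_⟩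
  have := hf.2 K hK hx
  simpa using this

theorem isProjCover_comp_equiv {f : M →ₗ[Λ] X} (hf : IsProjCover f) (e : X ≃ₗ[Λ] Y) :
    IsProjCover (e.toLinearMap ∘ₗ f) := by
  refine ⟨hf.projective, e.surjective.comp hf.surjective, ?_⟩
  rw [LinearEquiv.ker_comp]
  exact hf.superfluous

theorem ker_equiv {p : M →ₗ[Λ] X} {q : N →ₗ[Λ] X} (e : M ≃ₗ[Λ] N)
    (h : q ∘ₗ e.toLinearMap = p) : Nonempty (LinearMap.ker p ≃ₗ[Λ] LinearMap.ker q) := by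
  refine ⟨e.ofSubmodules _ _ ?_⟩
  ext x
  subst h
  constructor
  · rintro ⟨y, hy, rfl⟩
    exact hy
  · intro hx
    exact ⟨e.symm x, by simpa using hx, by simp⟩

theorem nat_length [IsNoetherian Λ M] [IsArtinian Λ M] : ∃ n : ℕ, Module.length Λ M = n := by
  obtain ⟨n, hn⟩ := ENat.ne_top_iff_exists.1 (Module.length_ne_top (R := Λ) (M := M))
  exact ⟨n, hn.symm⟩

theorem chain_step [IsNoetherian Λ M] [IsArtinian Λ M] [IsNoetherian Λ N] [IsArtinian Λ N]
    [IsSimpleModule Λ X] {f : M →ₗ[Λ] X}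
    (hf : LocalCov f) (G : M →ₗ[Λ] N) (hG : G ≠ 0) (g : Y →ₗ[Λ] M)
    (hg : LinearMap.range g = LinearMap.ker f) :
    Module.length Λ (LinearMap.range (G ∘ₗ g)) + 1 = Module.length Λ (LinearMap.range G) := by
  have h1 := length_ker_surj f hf.1
  have h2 := length_ker_range G
  have h3 := length_ker_range (G ∘ₗ (LinearMap.ker f).subtype)
  have h4 : LinearMap.range (G ∘ₗ (LinearMap.ker f).subtype) = LinearMap.range (G ∘ₗ g) := by
    rw [LinearMap.range_comp, LinearMap.range_comp, hg, Submodule.range_subtype]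
  have h5 : LinearMap.ker G ≤ LinearMap.ker f :=
    hf.2 _ fun h => hG (LinearMap.ker_eq_top.1 h)
  have h6 : Module.length Λ (LinearMap.ker (G ∘ₗ (LinearMap.ker f).subtype)) =
      Module.length Λ (LinearMap.ker G) := by
    rw [LinearMap.ker_comp]
    exact (Submodule.comapSubtypeEquivOfLe h5).length_eq
  have h7 : Module.length Λ X = 1 := Module.length_eq_one Λ X
  rw [h6, h4] at h3
  rw [h7, h3] at h1
  obtain ⟨a, ha⟩ := nat_length (Λ := Λ) (M := LinearMap.ker G)
  obtain ⟨b, hb⟩ := nat_length (Λ := Λ) (M := LinearMap.range (G ∘ₗ g))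
  obtain ⟨c, hc⟩ := nat_length (Λ := Λ) (M := LinearMap.range G)
  rw [h2, ha, hb, hc] at h1
  rw [hb, hc]
  norm_cast at h1 ⊢
  omega

variable {ι : Type} {L : ι → Submodule Λ Λ} {F : ι → ModuleCat.{u} Λ}
  {f : ∀ i, L i →ₗ[Λ] F i}

theorem chain [IsArtinianRing Λ] (hF : ∀ i, IsSimpleModule Λ (F i)) (hloc : ∀ i, LocalCov (f i))
    (t : ι → ι) (hg : ∀ i, ∃ g : L (t i) →ₗ[Λ] L i, LinearMap.range g = LinearMap.ker (f i))
    (i : ι) (n : ℕ) : (n : ℕ∞) ≤ Module.length Λ (L i) →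
      ∃ G : L (t^[n] i) →ₗ[Λ] L i, Module.length Λ (LinearMap.range G) + n =
        Module.length Λ (L i) := by
  induction n with
  | zero =>
    intro _
    change ∃ G : L i →ₗ[Λ] L i, Module.length Λ (LinearMap.range G) + ((0 : ℕ) : ℕ∞) = _
    refine ⟨LinearMap.id, ?_⟩
    rw [LinearMap.range_id]
    simp
  | succ n ih =>
    intro hn
    obtain ⟨G, hG⟩ := ih (le_trans (by exact_mod_cast Nat.le_succ n) hn)
    obtain ⟨g, hgr⟩ := hg (t^[n] i)
    have hG0 : G ≠ 0 := by
      rintro rfl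
      rw [LinearMap.range_zero, Module.length_bot, zero_add] at hG
      rw [← hG] at hn
      norm_cast at hn
      omega
    have := hF (t^[n] i)
    have h1 := chain_step (hloc _) G hG0 g hgr
    rw [Function.iterate_succ_apply']
    refine ⟨G ∘ₗ g, ?_⟩
    rw [← hG, ← h1]
    push_cast
    ring

theorem sub_as_range [IsArtinianRing Λ] (hF : ∀ i, IsSimpleModule Λ (F i))
    (hloc : ∀ i, LocalCov (f i)) (huni : ∀ i, IsUniserialMod Λ (L i))
    (t : ι → ι) (hg : ∀ i, ∃ g : L (t i) →ₗ[Λ] L i, LinearMap.range g = LinearMap.ker (f i))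
    (i : ι) (K : Submodule Λ (L i)) :
      ∃ (n : ℕ) (G : L (t^[n] i) →ₗ[Λ] L i), LinearMap.range G = K ∧
        Module.length Λ K + n = Module.length Λ (L i) := by
  have h1 := length_ker_surj K.mkQ K.mkQ_surjective
  rw [Submodule.ker_mkQ] at h1
  obtain ⟨a, ha⟩ := nat_length (Λ := Λ) (M := K)
  obtain ⟨n, hn⟩ := nat_length (Λ := Λ) (M := L i ⧸ K)
  rw [hn] at h1
  obtain ⟨G, hG⟩ := chain hF hloc t hg i n (h1 ▸ le_add_self)
  refine ⟨n, G, ?_, h1.symm⟩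
  apply eq_of_length_uniserial (huni i)
  rw [h1] at hG
  exact WithTop.add_right_cancel (WithTop.natCast_ne_top n) hG

end Main

end Nak

/-- Let `Λ` be a connected Nakayama algebra with `s` simples and no simple projectives.
If `S` is simple with `|P(S)| > s`, then `|P(γS)| ≥ s` and `Ω²(H(S)) ≅ H(γS)`, where
`H(S)` denotes the length-`s` factor module of `P(S)` and syzygies are taken with respect
to projective covers. -/
theorem second_syzygy_of_primitive [IsNakayama Λ] (h0 : NoSimpleProjectives Λ)
    (hconn : IsConnectedAlg Λ) (s : ℕ) (hs : SimpleCount Λ s)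
    (S : Type u) [AddCommGroup S] [Module Λ S] (hS : IsSimpleModule Λ S)
    -- the projective cover P of S, of length > s
    (P : Type u) [AddCommGroup P] [Module Λ P] (p : P →ₗ[Λ] S) (hp : IsProjCover p)
    (pn : ℕ) (hPlen : HasLength Λ P pn) (hps : s < pn)
    -- H = H(S), the length-s factor module of P
    (H : Type u) [AddCommGroup H] [Module Λ H] (q : P →ₗ[Λ] H)
    (hq : Function.Surjective q) (hH : HasLength Λ H s)
    -- T = γ S, with projective cover P'
    (T : Type u) [AddCommGroup T] [Module Λ T] (hT : GammaRel Λ S T)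
    (P' : Type u) [AddCommGroup P'] [Module Λ P'] (p' : P' →ₗ[Λ] T) (hp' : IsProjCover p')
    -- Ω²(H) via projective covers r0, r1
    (Q0 : Type u) [AddCommGroup Q0] [Module Λ Q0] (r0 : Q0 →ₗ[Λ] H) (hr0 : IsProjCover r0)
    (Q1 : Type u) [AddCommGroup Q1] [Module Λ Q1] (r1 : Q1 →ₗ[Λ] LinearMap.ker r0)
    (hr1 : IsProjCover r1) :
    (∀ n, HasLength Λ P' n → s ≤ n) ∧
    ∀ (H' : Type u) [AddCommGroup H'] [Module Λ H'] (q' : P' →ₗ[Λ] H'),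
      Function.Surjective q' → HasLength Λ H' s →
      Nonempty ((LinearMap.ker r1) ≃ₗ[Λ] H') := by
  have hart : IsArtinianRing Λ := IsNakayama.artinian
  obtain ⟨F, hF, hFne, hFall⟩ := hs
  have hFinj : ∀ i j, Nonempty ((F i : Type u) ≃ₗ[Λ] (F j : Type u)) → i = j := by
    intro i j ⟨e⟩
    by_contra h
    exact (hFne i j h).false e
  have hFnt : ∀ i, Nontrivial (F i) := fun i => IsSimpleModule.nontrivial Λ (F i)
  choose L f hproj hloc huni using fun i => Nak.exists_cover (Λ := Λ) (F i)
  -- the next simple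
  have hker : ∀ i, ∃ k, ∃ α : LinearMap.ker (f i) →ₗ[Λ] F k, Function.Surjective α := by
    intro i
    have hnt : Nontrivial (LinearMap.ker (f i)) := by
      rw [Submodule.nontrivial_iff_ne_bot]
      intro hb
      have e : L i ≃ₗ[Λ] F i := LinearEquiv.ofBijective (f i) ⟨LinearMap.ker_eq_bot.1 hb, (hloc i).1⟩
      exact h0 (F i) (hF i) (Module.Projective.of_equiv e)
    obtain ⟨K, hK⟩ := Nak.exists_simple_quot (Λ := Λ) (LinearMap.ker (f i))
    obtain ⟨k, ⟨e⟩⟩ := hFall _ hK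
    exact ⟨k, e.toLinearMap ∘ₗ K.mkQ, e.surjective.comp K.mkQ_surjective⟩
  choose t α hα using hker
  have hg : ∀ i, ∃ g : L (t i) →ₗ[Λ] L i, LinearMap.range g = LinearMap.ker (f i) := by
    intro i
    have := hproj (t i)
    obtain ⟨g, hg⟩ := Module.projective_lifting_property (α i) (f (t i)) (hα i)
    have hl := Nak.localCov_of_uniserial (Nak.uniserial_sub (huni i) _) (α i) (hα i)
    have hgs : Function.Surjective g := hl.surj g (by
      rw [hg]
      intro h
      obtain ⟨x, hx⟩ := exists_ne (0 : F (t i))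
      obtain ⟨y, rfl⟩ := (hloc (t i)).1 x
      exact hx (LinearMap.congr_fun h y))
    refine ⟨(LinearMap.ker (f i)).subtype ∘ₗ g, ?_⟩
    rw [LinearMap.range_comp, LinearMap.range_eq_top.2 hgs, Submodule.map_top,
      Submodule.range_subtype]
  have htinj : Function.Injective t := by
    intro i j hij
    have hβ : ∃ β : LinearMap.ker (f j) →ₗ[Λ] F (t i), Function.Surjective β := by
      rw [hij]; exact ⟨α j, hα j⟩
    obtain ⟨β, hβ⟩ := hβ
    exact hFinj i j (Nak.top_unique (hloc i) (hloc j) (α i) (hα i) β hβ)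
  have hsub := Nak.sub_as_range hF hloc huni t hg
  -- nonzero maps
  have hnz : ∀ i j, ∀ φ : L j →ₗ[Λ] L i, φ ≠ 0 → ∃ n, j = t^[n] i := by
    intro i j φ hφ
    obtain ⟨n, G, hG, _⟩ := hsub i (LinearMap.range φ)
    refine ⟨n, ?_⟩
    have : Nontrivial (LinearMap.range φ) :=
      Submodule.nontrivial_iff_ne_bot.2 fun h => hφ (LinearMap.range_eq_bot.1 h)
    obtain ⟨K, hK⟩ := Nak.exists_simple_quot (Λ := Λ) (LinearMap.range φ)
    obtain ⟨e1⟩ := (hloc j).top_iso (K.mkQ ∘ₗ φ.rangeRestrict)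
      (K.mkQ_surjective.comp φ.surjective_rangeRestrict)
    obtain ⟨e2⟩ := (hloc (t^[n] i)).top_iso
      (K.mkQ ∘ₗ (LinearEquiv.ofEq _ _ hG).toLinearMap ∘ₗ G.rangeRestrict)
      (K.mkQ_surjective.comp ((LinearEquiv.ofEq _ _ hG).surjective.comp G.surjective_rangeRestrict))
    exact hFinj _ _ ⟨e1.trans e2.symm⟩
  obtain ⟨i0, ⟨eS⟩⟩ := hFall S hS
  -- the cycle
  let σ : Equiv.Perm (Fin s) := Equiv.ofBijective t (Finite.injective_iff_bijective.1 htinj)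
  have hσ : ∀ n i, t^[n] i = (σ ^ n) i := by
    intro n i
    rw [← Equiv.Perm.iterate_eq_pow]
    rfl
  have hall : ∀ j, σ.SameCycle i0 j := by
    refine Nak.connected_all hconn L hproj ?_ ?_ {j | σ.SameCycle i0 j} ⟨i0, ?_⟩ ?_ ?_
    · intro i hi
      obtain ⟨x, hx⟩ := exists_ne (0 : F i)
      obtain ⟨y, rfl⟩ := (hloc i).1 x
      apply hx
      have : y = 0 := by
        have h1 : (y : Λ) ∈ (⊥ : Submodule Λ Λ) := hi.le y.2
        exact Subtype.ext ((Submodule.mem_bot Λ).1 h1)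
      rw [this, map_zero]
    · intro M _ _ hM
      obtain ⟨x, hx⟩ := exists_ne (0 : M)
      have hspan : Nontrivial (Submodule.span Λ {x}) :=
        Submodule.nontrivial_iff_ne_bot.2 (by simpa using hx)
      obtain ⟨K, hK⟩ := Nak.exists_simple_quot (Λ := Λ) M
      obtain ⟨k, ⟨e⟩⟩ := hFall _ hK
      have := hproj k
      obtain ⟨φ, hφ⟩ := Module.projective_lifting_property (e.toLinearMap ∘ₗ K.mkQ) (f k)
        (e.surjective.comp K.mkQ_surjective)
      refine ⟨k, φ, ?_⟩
      rintro rfl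
      obtain ⟨x, hx⟩ := exists_ne (0 : F k)
      obtain ⟨y, rfl⟩ := (hloc k).1 x
      apply hx
      rw [← hφ]; simp
    · exact Equiv.Perm.SameCycle.refl _ _
    · intro i hi j hj φ
      by_contra hφ
      obtain ⟨n, rfl⟩ := hnz i j φ hφ
      apply hj
      rw [Set.mem_setOf_eq, hσ]
      exact Equiv.Perm.sameCycle_pow_right.2 hi
    · intro i hi j hj φ
      by_contra hφ
      obtain ⟨n, rfl⟩ := hnz j i φ hφ
      apply hj
      rw [Set.mem_setOf_eq, hσ] at hi
      exact Equiv.Perm.sameCycle_pow_right.1 hi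
  have hcyc : t^[s] i0 = i0 := by
    have h : σ.IsCycleOn ((Finset.univ : Finset (Fin s)) : Set (Fin s)) := by
      refine ⟨by simpa using σ.bijective.bijOn_univ, fun x _ y _ => ?_⟩
      exact (hall x).symm.trans (hall y)
    have := h.pow_card_apply (Finset.mem_univ i0)
    rw [Finset.card_univ, Fintype.card_fin] at this
    rw [hσ]; exact this
  have hs0 : 0 < s := i0.pos
  have hSnt : Nontrivial S := IsSimpleModule.nontrivial Λ S
  have hcovS : IsProjCover (eS.symm.toLinearMap ∘ₗ f i0) :=
    (hloc i0).isProjCover (hproj i0) _ (eS.symm.surjective.comp (hloc i0).1)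
  obtain ⟨eP, -⟩ := Nak.cover_unique hp hcovS
  have hlen : Module.length Λ (L i0) = pn := by
    rw [← eP.length_eq, Nak.length_of_hasLength hPlen]
  have hHlen := Nak.length_of_hasLength hH
  have hHnt : Nontrivial H := by
    rw [← Module.length_pos_iff (R := Λ), hHlen]
    exact_mod_cast hs0
  -- first syzygy
  let q0 : L i0 →ₗ[Λ] H := q ∘ₗ eP.symm.toLinearMap
  have hq0 : Function.Surjective q0 := hq.comp eP.symm.surjective
  have hcovH : IsProjCover q0 := (hloc i0).isProjCover (hproj i0) q0 hq0
  obtain ⟨e0, he0⟩ := Nak.cover_unique hr0 hcovH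
  obtain ⟨k0⟩ := Nak.ker_equiv e0 he0
  have hl0 := Nak.length_ker_surj q0 hq0
  obtain ⟨a, ha⟩ := Nak.nat_length (Λ := Λ) (M := LinearMap.ker q0)
  rw [hlen, hHlen, ha] at hl0
  have hl0' : pn = a + s := by exact_mod_cast hl0
  have hGs : ∃ G : L i0 →ₗ[Λ] L i0, LinearMap.range G = LinearMap.ker q0 := by
    obtain ⟨n, G, hG, hn⟩ := hsub i0 (LinearMap.ker q0)
    rw [ha, hlen] at hn
    have hn' : a + n = pn := by exact_mod_cast hn
    have hns : n = s := by omega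
    subst hns
    have h : ∀ j, j = i0 → ∀ G : L j →ₗ[Λ] L i0, LinearMap.range G = LinearMap.ker q0 →
        ∃ G : L i0 →ₗ[Λ] L i0, LinearMap.range G = LinearMap.ker q0 := by
      rintro j rfl G hG
      exact ⟨G, hG⟩
    exact h _ hcyc G hG
  obtain ⟨G, hG⟩ := hGs
  have hk0nt : Nontrivial (LinearMap.ker q0) := by
    rw [← Module.length_pos_iff (R := Λ), ha]
    have : 0 < a := by omega
    exact_mod_cast this
  let π : L i0 →ₗ[Λ] LinearMap.ker q0 := (LinearEquiv.ofEq _ _ hG).toLinearMap ∘ₗ G.rangeRestrict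
  have hπ : Function.Surjective π :=
    (LinearEquiv.ofEq _ _ hG).surjective.comp G.surjective_rangeRestrict
  have hcovπ : IsProjCover π := (hloc i0).isProjCover (hproj i0) π hπ
  obtain ⟨e1, he1⟩ := Nak.cover_unique (Nak.isProjCover_comp_equiv hr1 k0) hcovπ
  obtain ⟨k1⟩ := Nak.ker_equiv e1 he1
  rw [LinearEquiv.ker_comp] at k1
  -- second syzygy
  have hl1 := Nak.length_ker_surj π hπ
  obtain ⟨b, hb⟩ := Nak.nat_length (Λ := Λ) (M := LinearMap.ker π)
  rw [hlen, ha, hb] at hl1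
  have hl1' : pn = b + a := by exact_mod_cast hl1
  have hbs : b = s := by omega
  subst hbs
  obtain ⟨n', G', hG', hn'⟩ := hsub i0 (LinearMap.ker π)
  rw [hb, hlen] at hn'
  have hn1 : b + n' = pn := by exact_mod_cast hn'
  -- the simple `γ S`
  obtain ⟨-, P0, p0, hp0, V, hV, ⟨iV, hiV, -⟩, -, hTs, L2, hL2, ⟨-, pV, hpV, hpVk⟩, iT, hiT, -⟩ := hT
  obtain ⟨eP0, -⟩ := Nak.cover_unique hp0 hcovS
  let j : V →ₗ[Λ] L i0 := eP0.toLinearMap ∘ₗ iV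
  have hj : Function.Injective j := eP0.injective.comp hiV
  obtain ⟨n2, G2, hG2, hn2⟩ := hsub i0 (LinearMap.range j)
  rw [← (LinearEquiv.ofInjective j hj).length_eq, Module.length_eq_one Λ V, hlen] at hn2
  have hn2' : 1 + n2 = pn := by exact_mod_cast hn2
  obtain ⟨eV⟩ := (hloc (t^[n2] i0)).top_iso
    ((LinearEquiv.ofInjective j hj).symm.toLinearMap ∘ₗ
      (LinearEquiv.ofEq _ _ hG2).toLinearMap ∘ₗ G2.rangeRestrict)
    ((LinearEquiv.ofInjective j hj).symm.surjective.comp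
      ((LinearEquiv.ofEq _ _ hG2).surjective.comp G2.surjective_rangeRestrict))
  have htv : t (t^[n2] i0) = t^[n'] i0 := by
    rw [← Function.iterate_succ_apply' t n2 i0]
    have : n2 + 1 = n' + b := by omega
    rw [Nat.succ_eq_add_one, this, Function.iterate_add_apply, hcyc]
  generalize t^[n2] i0 = v at *
  have hVnt : Nontrivial V := IsSimpleModule.nontrivial Λ V
  have := hproj v
  obtain ⟨h, hh⟩ := Module.projective_lifting_property pV (eV.toLinearMap ∘ₗ f v) hpV
  have hlocV := Nak.localCov_of_ker_le hpV hpVk.le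
  have hhs : Function.Surjective h := Nak.surj_of_comp_surj hpVk.le h
    (by rw [hh]; exact eV.surjective.comp (hloc v).1)
  obtain ⟨hL2n, hL2a⟩ := Nak.finite_of_hasLength hL2
  have hL2l := Nak.length_of_hasLength hL2
  have hTl := (LinearEquiv.ofInjective iT hiT).length_eq
  rw [Module.length_eq_one Λ T] at hTl
  have hkl := Nak.length_ker_surj pV hpV
  rw [hL2l, Module.length_eq_one Λ V] at hkl
  obtain ⟨c, hc⟩ := Nak.nat_length (Λ := Λ) (M := LinearMap.ker pV)
  rw [hc] at hkl
  have hc1 : 2 = c + 1 := by exact_mod_cast hkl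
  have hrT : LinearMap.range iT = LinearMap.ker pV := by
    apply Nak.eq_of_length
    · apply hlocV.2
      intro htop
      rw [htop, Module.length_top, hL2l] at hTl
      norm_cast at hTl
    · rw [← hTl, hc]
      have : c = 1 := by omega
      rw [this]; rfl
  obtain ⟨g, hgr⟩ := hg v
  have hrg : LinearMap.range (h ∘ₗ g) = LinearMap.range iT := by
    rw [LinearMap.range_comp, hgr, hrT]
    ext x
    constructor
    · rintro ⟨y, hy, rfl⟩
      have h1 : pV (h y) = eV (f v y) := LinearMap.congr_fun hh y
      have h2 : f v y = 0 := hy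
      rw [LinearMap.mem_ker, h1, h2, map_zero]
    · intro hx
      obtain ⟨y, rfl⟩ := hhs x
      have h1 : pV (h y) = eV (f v y) := LinearMap.congr_fun hh y
      rw [LinearMap.mem_ker, h1] at hx
      exact ⟨y, by simpa using hx, rfl⟩
  obtain ⟨eT⟩ := (hloc (t v)).top_iso
    ((LinearEquiv.ofInjective iT hiT).symm.toLinearMap ∘ₗ
      (LinearEquiv.ofEq _ _ hrg).toLinearMap ∘ₗ (h ∘ₗ g).rangeRestrict)
    ((LinearEquiv.ofInjective iT hiT).symm.surjective.comp
      ((LinearEquiv.ofEq _ _ hrg).surjective.comp (h ∘ₗ g).surjective_rangeRestrict))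
  rw [htv] at eT
  generalize t^[n'] i0 = w at *
  have hTnt : Nontrivial T := IsSimpleModule.nontrivial Λ T
  have hcovT : IsProjCover (eT.toLinearMap ∘ₗ f w) :=
    (hloc w).isProjCover (hproj w) _ (eT.surjective.comp (hloc w).1)
  obtain ⟨eP', -⟩ := Nak.cover_unique hp' hcovT
  let ρ : L w →ₗ[Λ] LinearMap.ker π := (LinearEquiv.ofEq _ _ hG').toLinearMap ∘ₗ G'.rangeRestrict
  have hρ : Function.Surjective ρ :=
    (LinearEquiv.ofEq _ _ hG').surjective.comp G'.surjective_rangeRestrict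
  constructor
  · intro n hn
    have h1 := Module.length_le_of_surjective ρ hρ
    rw [hb, ← eP'.length_eq, Nak.length_of_hasLength hn] at h1
    exact_mod_cast h1
  · intro H' _ _ q' hq' hH'
    obtain ⟨e⟩ := Nak.quot_iso_of_length (huni w) ρ (q' ∘ₗ eP'.symm.toLinearMap) hρ
      (hq'.comp eP'.symm.surjective) (by rw [hb, Nak.length_of_hasLength hH'])
    exact ⟨k1.trans e⟩
end

section
/- An indecomposable non-projective module M over a Nakayama algebra is Gorenstein projective if and only if there is an exact sequence 0 → M → P_{n-1} → ⋯ → P_0 → M → 0 in which all P_i are minimal projective modules. -/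
universe u

variable (Λ : Type u) [Ring Λ]

/-- `M` admits an exact sequence `0 → M → P_{n-1} → ⋯ → P_0 → M → 0` with all `P_i`
minimal projective. Encoded as a chain `C (n+1) ≅ M → C n → ⋯ → C 1 → C 0 ≅ M` (`n ≥ 1`)
with `C 1, …, C n` minimal projective. -/
def HasPeriodicMinimalResolution (M : Type u) [AddCommGroup M] [Module Λ M] : Prop :=
  ∃ (n : ℕ) (C : ℕ → ModuleCat.{u} Λ) (f : ∀ i, C (i + 1) →ₗ[Λ] C i),
    1 ≤ n ∧
    Nonempty ((C 0 : Type u) ≃ₗ[Λ] M) ∧ Nonempty ((C (n + 1) : Type u) ≃ₗ[Λ] M) ∧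
    (∀ i, 1 ≤ i → i ≤ n → IsMinimalProjective Λ (C i)) ∧
    Function.Injective (f n) ∧ Function.Surjective (f 0) ∧
    ∀ j, j + 1 ≤ n → Function.Exact (f (j + 1)) (f j)

section Helpers

variable {Λ}

instance nakArtinian [h : IsNakayama Λ] : IsArtinianRing Λ := h.artinian

theorem nak_finite_of_hasLength {M : Type u} [AddCommGroup M] [Module Λ M]
    (h : ∃ n, HasLength Λ M n) : Module.Finite Λ M := by
  obtain ⟨n, c, h0, h1, hc⟩ := h
  let s : CompositionSeries (Submodule Λ M) :=
    { length := n
      toFun := c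
      step := fun i => hc i }
  have : IsFiniteLength Λ M :=
    isFiniteLength_of_exists_compositionSeries ⟨s, h0, h1⟩
  have := (isFiniteLength_iff_isNoetherian_isArtinian.mp this).1
  infer_instance

theorem nak_hasLength_of_finite [IsArtinianRing Λ] {M : Type u} [AddCommGroup M] [Module Λ M]
    [Module.Finite Λ M] : ∃ n, HasLength Λ M n := by
  obtain ⟨s, h0, h1⟩ := exists_compositionSeries_of_isNoetherian_isArtinian Λ M
  exact ⟨s.length, s.toFun, h0, h1, fun i => s.step i⟩

theorem nak_uniserial [IsNakayama Λ] {M : Type u} [AddCommGroup M] [Module Λ M]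
    [Module.Finite Λ M] (h : IsIndecomposableMod Λ M) : IsUniserialMod Λ M :=
  IsNakayama.serial M nak_hasLength_of_finite h

section Uniserial

variable {M N : Type u} [AddCommGroup M] [Module Λ M] [AddCommGroup N] [Module Λ N]

theorem uni_of_injective (h : IsUniserialMod Λ N) (f : M →ₗ[Λ] N) (hf : Function.Injective f) :
    IsUniserialMod Λ M := fun A B => by
  rcases h (A.map f) (B.map f) with h | h
  · exact Or.inl ((Submodule.map_le_map_iff_of_injective hf A B).1 h)
  · exact Or.inr ((Submodule.map_le_map_iff_of_injective hf B A).1 h)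

theorem uni_of_surjective (h : IsUniserialMod Λ M) (f : M →ₗ[Λ] N) (hf : Function.Surjective f) :
    IsUniserialMod Λ N := fun A B => by
  rcases h (A.comap f) (B.comap f) with h | h
  · exact Or.inl ((Submodule.comap_le_comap_iff_of_surjective hf).1 h)
  · exact Or.inr ((Submodule.comap_le_comap_iff_of_surjective hf).1 h)

theorem uni_sup (h : IsUniserialMod Λ M) {A B : Submodule Λ M} (hs : A ⊔ B = ⊤) :
    A = ⊤ ∨ B = ⊤ := by
  rcases h A B with h | h
  · right; rwa [sup_eq_right.2 h] at hs
  · left; rwa [sup_eq_left.2 h] at hs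

theorem uni_inf (h : IsUniserialMod Λ M) {A B : Submodule Λ M} (hs : A ⊓ B = ⊥) :
    A = ⊥ ∨ B = ⊥ := by
  rcases h A B with h | h
  · left; rwa [inf_eq_left.2 h] at hs
  · right; rwa [inf_eq_right.2 h] at hs

theorem uni_indec [hn : Nontrivial M] (h : IsUniserialMod Λ M) : IsIndecomposableMod Λ M :=
  ⟨hn, fun _ _ hc => uni_inf h hc.inf_eq_bot⟩

theorem uni_le_rad (h : IsUniserialMod Λ M) {A : Submodule Λ M} (hA : A ≠ ⊤) :
    A ≤ modRadical Λ M := by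
  refine le_sInf fun C hC => ?_
  rcases h A C with h | h
  · exact h
  · rcases eq_or_lt_of_le h with h | h
    · exact h.ge
    · exact absurd (hC.2 _ h) hA

theorem rad_ne_top [Nontrivial M] [Module.Finite Λ M] : modRadical Λ M ≠ ⊤ := by
  obtain ⟨C, hC⟩ := IsCoatomic.exists_coatom (Submodule Λ M)
  intro h
  exact hC.1 (top_le_iff.1 (h ▸ sInf_le hC))

/-- A surjection from a uniserial module onto a nonzero projective module is injective. -/
theorem uni_inj_of_projective [Module.Projective Λ N] [Nontrivial N] (h : IsUniserialMod Λ M)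
    (f : M →ₗ[Λ] N) (hf : Function.Surjective f) : Function.Injective f := by
  obtain ⟨s, hs⟩ := Module.projective_lifting_property f LinearMap.id hf
  have hs' : ∀ x, f (s x) = x := fun x => LinearMap.congr_fun hs x
  have : LinearMap.ker f ⊓ LinearMap.range s = ⊥ := by
    rw [eq_bot_iff]
    rintro _ ⟨h1, x, rfl⟩
    have h1 : f (s x) = 0 := h1
    rw [hs'] at h1
    simp [h1]
  rcases uni_inf h this with h | h
  · exact LinearMap.ker_eq_bot.1 h
  · exfalso
    obtain ⟨x, hx⟩ := exists_ne (0 : N)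
    have : s = 0 := LinearMap.range_eq_bot.1 h
    apply hx
    rw [← hs' x, this]; simp

end Uniserial

/-- Generic indecomposable direct summand. -/
theorem exists_indec_summand [IsArtinianRing Λ] {E : Type u} [AddCommGroup E] [Module Λ E]
    [Module.Finite Λ E] (Φ : (E →ₗ[Λ] E) → Prop) (h1 : Φ LinearMap.id) (h0 : ¬ Φ 0)
    (hadd : ∀ a b, Φ (a + b) → Φ a ∨ Φ b) :
    ∃ (A : Submodule Λ E) (r : E →ₗ[Λ] A), (∀ x : A, r x = x) ∧ Φ (A.subtype.comp r) ∧
      IsIndecomposableMod Λ A := by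
  let S : Set (Submodule Λ E) := {A | ∃ r : E →ₗ[Λ] A, (∀ x : A, r x = x) ∧ Φ (A.subtype.comp r)}
  have hne : S.Nonempty := ⟨⊤, LinearMap.codRestrict ⊤ LinearMap.id (fun _ => trivial),
    fun x => rfl, h1⟩
  obtain ⟨A, ⟨r, hr, hΦ⟩, hmin⟩ := wellFounded_lt.has_min S hne
  have key : ∀ (N N' : Submodule Λ A) (hc : IsCompl N N'),
      Φ (A.subtype.comp ((N.subtype.comp (N.projectionOnto N' hc)).comp r)) → N' = ⊥ := by
    intro N N' hc h
    have hmem : N.map A.subtype ∈ S := by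
      let r' : E →ₗ[Λ] N.map A.subtype := LinearMap.codRestrict _
        (A.subtype.comp ((N.subtype.comp (N.projectionOnto N' hc)).comp r))
        (fun x => ⟨_, Subtype.property _, rfl⟩)
      refine ⟨r', ?_, h⟩
      rintro ⟨_, x, hx, rfl⟩
      apply Subtype.ext
      change ((N.projectionOnto N' hc (r (x : E)) : A) : E) = x
      rw [hr]
      have := Submodule.projectionOnto_apply_left hc ⟨x, hx⟩
      simp at this
      rw [this]
    have hle : N.map A.subtype ≤ A := by
      rintro _ ⟨x, hx, rfl⟩; exact x.2
    have heq : N.map A.subtype = A := by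
      by_contra hne
      exact hmin _ hmem (lt_of_le_of_ne hle hne)
    have : N = ⊤ := by
      rw [eq_top_iff]
      intro x _
      have hx : (x : E) ∈ N.map A.subtype := heq.ge x.2
      obtain ⟨y, hy, hyx⟩ := hx
      have : y = x := Subtype.ext hyx
      rwa [← this]
    subst this
    simpa using hc.inf_eq_bot
  refine ⟨A, r, hr, hΦ, ?_, ?_⟩
  · by_contra hn
    rw [not_nontrivial_iff_subsingleton] at hn
    apply h0
    convert hΦ
    ext x
    have : r x = 0 := Subsingleton.elim _ _
    simp [this]
  · intro N N' hc
    have : A.subtype.comp r = A.subtype.comp ((N.subtype.comp (N.projectionOnto N' hc)).comp r)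
      + A.subtype.comp ((N'.subtype.comp (N'.projectionOnto N hc.symm)).comp r) := by
      ext x
      have := Submodule.projection_add_projection_eq_self hc (r x)
      have := congrArg Subtype.val this
      simpa using this.symm
    rw [this] at hΦ
    rcases hadd _ _ hΦ with h | h
    · right; exact key _ _ hc h
    · left; exact key _ _ hc.symm h

theorem exists_summand_inj [IsArtinianRing Λ] {U E : Type u} [AddCommGroup E] [Module Λ E]
    [AddCommGroup U] [Module Λ U] [Module.Finite Λ E] [Nontrivial U] (hU : IsUniserialMod Λ U)
    (κ : U →ₗ[Λ] E) (hκ : Function.Injective κ) :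
    ∃ (A : Submodule Λ E) (r : E →ₗ[Λ] A), (∀ x : A, r x = x) ∧
      Function.Injective (r.comp κ) ∧ IsIndecomposableMod Λ A := by
  obtain ⟨A, r, hr, hΦ, hA⟩ := exists_indec_summand (E := E)
    (fun e => LinearMap.ker (e.comp κ) = ⊥) (by simpa using LinearMap.ker_eq_bot.2 hκ)
    (by simp) (by
      intro a b h
      apply uni_inf hU
      rw [eq_bot_iff, ← h]
      rintro x ⟨h1, h2⟩
      have h1 : a (κ x) = 0 := h1
      have h2 : b (κ x) = 0 := h2
      simp [h1, h2])
  refine ⟨A, r, hr, ?_, hA⟩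
  have := LinearMap.ker_eq_bot.1 hΦ
  exact Function.Injective.of_comp (f := A.subtype) this

theorem exists_summand_surj [IsArtinianRing Λ] {U E : Type u} [AddCommGroup E] [Module Λ E]
    [AddCommGroup U] [Module Λ U] [Module.Finite Λ E] [Nontrivial U] (hU : IsUniserialMod Λ U)
    (π : E →ₗ[Λ] U) (hπ : Function.Surjective π) :
    ∃ (A : Submodule Λ E) (r : E →ₗ[Λ] A), (∀ x : A, r x = x) ∧
      Function.Surjective (π.comp A.subtype) ∧ IsIndecomposableMod Λ A := by
  obtain ⟨A, r, hr, hΦ, hA⟩ := exists_indec_summand (E := E)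
    (fun e => LinearMap.range (π.comp e) = ⊤) (by simpa using LinearMap.range_eq_top.2 hπ)
    (by simp) (by
      intro a b h
      apply uni_sup hU
      rw [eq_top_iff, ← h]
      rintro _ ⟨x, rfl⟩
      simp only [LinearMap.comp_add, LinearMap.add_apply]
      exact Submodule.add_mem_sup ⟨x, rfl⟩ ⟨x, rfl⟩)
  refine ⟨A, r, hr, ?_, hA⟩
  have := LinearMap.range_eq_top.1 hΦ
  exact Function.Surjective.of_comp (g := r) this

theorem summand_projective {E : Type u} [AddCommGroup E] [Module Λ E] [Module.Projective Λ E]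
    (A : Submodule Λ E) (r : E →ₗ[Λ] A) (hr : ∀ x : A, r x = x) : Module.Projective Λ A :=
  Module.Projective.of_split A.subtype r (LinearMap.ext hr)

theorem exists_cover [IsArtinianRing Λ] {U : Type u} [AddCommGroup U] [Module Λ U]
    [Module.Finite Λ U] [Nontrivial U] (hU : IsUniserialMod Λ U) :
    ∃ (A : ModuleCat.{u} Λ) (π : A →ₗ[Λ] U), Module.Finite Λ A ∧ Module.Projective Λ A ∧
      IsIndecomposableMod Λ A ∧ Function.Surjective π := by
  obtain ⟨n, f, hf⟩ := Module.Finite.exists_fin' Λ U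
  obtain ⟨A, r, hr, hs, hA⟩ := exists_summand_surj hU f hf
  exact ⟨ModuleCat.of Λ A, f.comp A.subtype, inferInstanceAs (Module.Finite Λ A),
    summand_projective A r hr, hA, hs⟩

/-- A uniserial module with a nonzero projective submodule is projective. -/
theorem projective_of_sub [IsNakayama Λ] {Z : Type u} [AddCommGroup Z] [Module Λ Z]
    [Module.Finite Λ Z] (hZ : IsUniserialMod Λ Z) (Y : Submodule Λ Z) (hY : Y ≠ ⊥)
    [Module.Projective Λ Y] : Module.Projective Λ Z := by
  have : Nontrivial Y := (Submodule.nontrivial_iff_ne_bot).2 hY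
  have : Nontrivial Z := Y.subtype_injective.nontrivial
  obtain ⟨A, π, hfin, hproj, hind, hπ⟩ := exists_cover hZ
  have hAu := nak_uniserial hind
  let g : Y.comap π →ₗ[Λ] Y := π.restrict (fun x hx => hx)
  have hg : Function.Surjective g := by
    rintro ⟨y, hy⟩
    obtain ⟨x, rfl⟩ := hπ y
    exact ⟨⟨x, hy⟩, rfl⟩
  have hgi := uni_inj_of_projective
    (uni_of_injective hAu (Y.comap π).subtype (Submodule.subtype_injective _)) g hg
  have hinj : Function.Injective π := by
    rw [← LinearMap.ker_eq_bot, eq_bot_iff]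
    intro x hx
    have hx : π x = 0 := hx
    have hm : x ∈ Y.comap π := by simp [hx]
    have : g ⟨x, hm⟩ = g 0 := by
      rw [map_zero]; exact Subtype.ext hx
    have := congrArg Subtype.val (hgi this)
    simpa using this
  exact Module.Projective.of_equiv (LinearEquiv.ofBijective π ⟨hinj, hπ⟩)

/-- Nonzero projective submodules of minimal projectives are everything. -/
theorem minproj_sub [IsNakayama Λ] {P : Type u} [AddCommGroup P] [Module Λ P]
    [Module.Finite Λ P] (hP : IsMinimalProjective Λ P) (Y : Submodule Λ P) (hY : Y ≠ ⊥)
    (hproj : Module.Projective Λ Y) : Y = ⊤ := by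
  by_contra hne
  have hu := nak_uniserial hP.2.1
  have hle := uni_le_rad hu hne
  apply hP.2.2
  let Y' : Submodule Λ (modRadical Λ P) := Y.comap (modRadical Λ P).subtype
  let e : Y' ≃ₗ[Λ] Y := Submodule.comapSubtypeEquivOfLe hle
  have : Module.Projective Λ Y' := Module.Projective.of_equiv e.symm
  refine projective_of_sub (uni_of_injective hu _ (Submodule.subtype_injective _)) Y' ?_
  have : Nontrivial Y := (Submodule.nontrivial_iff_ne_bot).2 hY
  have : Nontrivial Y' := e.symm.injective.nontrivial
  exact (Submodule.nontrivial_iff_ne_bot).1 this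

theorem minproj_ext_indec [IsNakayama Λ] {X P Q : Type u} [AddCommGroup P] [Module Λ P]
    [AddCommGroup X] [Module Λ X] [AddCommGroup Q] [Module Λ Q]
    [Module.Finite Λ P] (hP : IsMinimalProjective Λ P) (ι : X →ₗ[Λ] P)
    (hι : Function.Injective ι) [Module.Finite Λ Q] [Module.Projective Λ Q]
    (hQ : IsIndecomposableMod Λ Q) (φ : X →ₗ[Λ] Q) : ∃ ψ : P →ₗ[Λ] Q, ψ.comp ι = φ := by
  have hPu := nak_uniserial hP.2.1
  have hQu := nak_uniserial hQ
  have := hQ.1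
  let D : Submodule Λ (P × Q) := LinearMap.range (ι.prod (-φ))
  let κ : Q →ₗ[Λ] (P × Q) ⧸ D := D.mkQ.comp (LinearMap.inr Λ P Q)
  let lam : P →ₗ[Λ] (P × Q) ⧸ D := D.mkQ.comp (LinearMap.inl Λ P Q)
  have hcomm : ∀ x, lam (ι x) = κ (φ x) := by
    intro x
    change D.mkQ (ι x, 0) = D.mkQ (0, φ x)
    rw [← sub_eq_zero, ← map_sub, Submodule.mkQ_apply, Submodule.Quotient.mk_eq_zero]
    exact ⟨x, by simp⟩
  have hκ : Function.Injective κ := by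
    rw [← LinearMap.ker_eq_bot, eq_bot_iff]
    intro q hq
    have hq : D.mkQ (0, q) = 0 := hq
    rw [Submodule.mkQ_apply, Submodule.Quotient.mk_eq_zero] at hq
    obtain ⟨x, hx⟩ := hq
    have hx : (ι x, -φ x) = ((0 : P), q) := hx
    obtain ⟨h1, h2⟩ := Prod.mk.inj hx
    have : x = 0 := hι (by simp [h1])
    subst this
    simpa using h2.symm
  obtain ⟨A, r, hr, hinj, hA⟩ := exists_summand_inj hQu κ hκ
  have hAu := nak_uniserial hA
  have hsup : LinearMap.range (r.comp κ) ⊔ LinearMap.range (r.comp lam) = ⊤ := by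
    rw [eq_top_iff]
    intro a _
    obtain ⟨⟨p, q⟩, hpq⟩ := D.mkQ_surjective (a : (P × Q) ⧸ D)
    have : a = r (κ q) + r (lam p) := by
      rw [← map_add, ← hr a, ← hpq]
      congr 1
      change D.mkQ (p, q) = D.mkQ (0, q) + D.mkQ (p, 0)
      rw [← map_add]; simp
    rw [this]
    exact Submodule.add_mem_sup ⟨q, rfl⟩ ⟨p, rfl⟩
  have htop : LinearMap.range (r.comp κ) = ⊤ := by
    rcases uni_sup hAu hsup with h | h
    · exact h
    · let e := LinearEquiv.ofInjective (r.comp κ) hinj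
      let Y := (LinearMap.range (r.comp κ)).comap (r.comp lam)
      let g₀ : Y →ₗ[Λ] LinearMap.range (r.comp κ) := (r.comp lam).restrict (fun x hx => hx)
      have hg₀ : Function.Surjective g₀ := by
        rintro ⟨y, hy⟩
        obtain ⟨x, rfl⟩ := LinearMap.range_eq_top.1 h y
        exact ⟨⟨x, hy⟩, rfl⟩
      let g : Y →ₗ[Λ] Q := e.symm.toLinearMap.comp g₀
      have hg : Function.Surjective g := e.symm.surjective.comp hg₀
      have hYu : IsUniserialMod Λ Y := uni_of_injective hPu Y.subtype (Submodule.subtype_injective _)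
      have hgi : Function.Injective g := uni_inj_of_projective hYu g hg
      let e' := LinearEquiv.ofBijective g ⟨hgi, hg⟩
      have hYp : Module.Projective Λ Y := Module.Projective.of_equiv e'.symm
      have hYn : Nontrivial Y := e'.symm.injective.nontrivial
      have hY := minproj_sub hP Y ((Submodule.nontrivial_iff_ne_bot).1 hYn) hYp
      rw [eq_top_iff, ← h]
      rintro _ ⟨x, rfl⟩
      have : x ∈ Y := hY ▸ trivial
      exact this
  let e := LinearEquiv.ofBijective (r.comp κ) ⟨hinj, LinearMap.range_eq_top.1 htop⟩
  refine ⟨e.symm.toLinearMap.comp (r.comp lam), ?_⟩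
  ext x
  simp only [LinearMap.comp_apply, hcomm, LinearEquiv.coe_coe]
  exact e.symm_apply_apply (φ x)

theorem minproj_ext [IsNakayama Λ] {X P Q : Type u} [AddCommGroup P] [Module Λ P]
    [AddCommGroup X] [Module Λ X] [AddCommGroup Q] [Module Λ Q]
    [Module.Finite Λ P] (hP : IsMinimalProjective Λ P) (ι : X →ₗ[Λ] P)
    (hι : Function.Injective ι) [Module.Finite Λ Q] [Module.Projective Λ Q]
    (φ : X →ₗ[Λ] Q) : ∃ ψ : P →ₗ[Λ] Q, ψ.comp ι = φ := by
  by_contra hcon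
  obtain ⟨A, r, hr, hΦ, hA⟩ := exists_indec_summand (E := Q)
    (fun e => ¬ ∃ ψ : P →ₗ[Λ] Q, ψ.comp ι = e.comp φ) (by simpa using hcon)
    (by simpa using ⟨0, by simp⟩) (by
      intro a b h
      by_contra hab
      push Not at hab
      obtain ⟨⟨ψ, h1⟩, ⟨ψ', h2⟩⟩ := hab
      exact h ⟨ψ + ψ', by rw [LinearMap.add_comp, h1, h2, LinearMap.add_comp]⟩)
  have := summand_projective A r hr
  obtain ⟨ψ, hψ⟩ := minproj_ext_indec hP ι hι hA (r.comp φ)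
  exact hΦ ⟨A.subtype.comp ψ, by rw [LinearMap.comp_assoc, hψ, LinearMap.comp_assoc]⟩

theorem exists_coatom_of_nontrivial [IsArtinianRing Λ] (P : Type u) [AddCommGroup P] [Module Λ P] :
    Nontrivial P → ∃ m : Submodule Λ P, IsCoatom m := by
  refine IsSemiprimaryRing.induction Λ Λ P
    (P := fun P _ _ _ => Nontrivial P → ∃ m : Submodule Λ P, IsCoatom m) ?_ ?_
  · intro M _ _ _ _ _ _ hM
    exact IsCoatomic.exists_coatom _
  · intro M _ _ _ _ N h1 h2 hM
    by_cases hq : Nontrivial (M ⧸ N)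
    · obtain ⟨m, hm⟩ := h2 hq
      refine ⟨m.comap N.mkQ, ?_⟩
      have := isSimpleModule_iff_isCoatom.2 hm
      rw [← isSimpleModule_iff_isCoatom]
      let f : M →ₗ[Λ] (M ⧸ N) ⧸ m := m.mkQ.comp N.mkQ
      have hf : Function.Surjective f := m.mkQ_surjective.comp N.mkQ_surjective
      have hk : LinearMap.ker f = m.comap N.mkQ := by
        simp [f, LinearMap.ker_comp]
      rw [← hk]
      exact IsSimpleModule.congr (f.quotKerEquivOfSurjective hf)
    · have hN : N = ⊤ := by
        rw [not_nontrivial_iff_subsingleton] at hq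
        exact Submodule.Quotient.subsingleton_iff.1 hq
      let e : N ≃ₗ[Λ] M := LinearEquiv.ofTop N hN
      obtain ⟨m, hm⟩ := h1 e.symm.injective.nontrivial
      exact ⟨_, (Submodule.orderIsoMapComap e).isCoatom_iff m |>.2 hm⟩

theorem exists_simple_quot [IsArtinianRing Λ] (P : Type u) [AddCommGroup P] [Module Λ P]
    [Nontrivial P] : ∃ (S : ModuleCat.{u} Λ) (f : P →ₗ[Λ] S), IsSimpleModule Λ S ∧
      Function.Surjective f := by
  obtain ⟨m, hm⟩ := exists_coatom_of_nontrivial (Λ := Λ) P inferInstance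
  exact ⟨ModuleCat.of Λ (P ⧸ m), m.mkQ, isSimpleModule_iff_isCoatom.2 hm, m.mkQ_surjective⟩

theorem uni_of_simple {S : Type u} [AddCommGroup S] [Module Λ S] [IsSimpleModule Λ S] :
    IsUniserialMod Λ S := fun A B => by
  rcases eq_bot_or_eq_top A with h | h
  · left; simp [h]
  · right; simp [h]

/-- An indecomposable projective module over a Nakayama algebra is finitely generated. -/
theorem finite_of_indec_proj [IsNakayama Λ] {P : Type u} [AddCommGroup P] [Module Λ P]
    (hp : Module.Projective Λ P) (hi : IsIndecomposableMod Λ P) : Module.Finite Λ P := by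
  have := hi.1
  obtain ⟨S, f, hS, hf⟩ := exists_simple_quot (Λ := Λ) P
  have := IsSimpleModule.nontrivial Λ S
  obtain ⟨A, π, hfin, hproj, hind, hπ⟩ := exists_cover (Λ := Λ) (U := S) uni_of_simple
  have hAu := nak_uniserial hind
  obtain ⟨g, hg⟩ := Module.projective_lifting_property f π hf
  obtain ⟨h, hh⟩ := Module.projective_lifting_property π f hπ
  have hcomp : ∀ x, π (h (g x)) = π x := fun x => by
    have h1 := LinearMap.congr_fun hh (g x)
    have h2 := LinearMap.congr_fun hg x
    simp only [LinearMap.comp_apply] at h1 h2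
    rw [h1, h2]
  have hsup : LinearMap.range (h.comp g) ⊔ LinearMap.ker π = ⊤ := by
    rw [eq_top_iff]
    intro x _
    have : x = h (g x) + (x - h (g x)) := by abel
    rw [this]
    exact Submodule.add_mem_sup ⟨x, rfl⟩ (by simp [hcomp])
  have hker : LinearMap.ker π ≠ ⊤ := by
    intro h
    obtain ⟨y, hy⟩ := exists_ne (0 : S)
    obtain ⟨x, rfl⟩ := hπ y
    have : x ∈ LinearMap.ker π := h ▸ trivial
    exact hy this
  have hsurj := LinearMap.range_eq_top.1 ((uni_sup hAu hsup).resolve_right hker)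
  have hinj : Function.Injective (h.comp g) :=
    IsNoetherian.injective_of_surjective_endomorphism _ hsurj
  have hc : IsCompl (LinearMap.range g) (LinearMap.ker h) := by
    constructor
    · rw [disjoint_iff, eq_bot_iff]
      rintro _ ⟨⟨x, rfl⟩, hx⟩
      have hx : h.comp g x = 0 := hx
      have : x = 0 := hinj (by simpa using hx)
      simp [this]
    · rw [codisjoint_iff, eq_top_iff]
      intro x _
      obtain ⟨y, hy⟩ := hsurj (h x)
      have : x = g y + (x - g y) := by abel
      rw [this]
      refine Submodule.add_mem_sup ⟨y, rfl⟩ ?_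
      simp only [LinearMap.mem_ker, map_sub]
      simp only [LinearMap.comp_apply] at hy
      rw [hy, sub_self]
  have hkh : LinearMap.ker h = ⊥ := by
    refine (hi.2 _ _ hc).resolve_left ?_
    intro h0
    have h0 := LinearMap.range_eq_bot.1 h0
    have := hind.1
    obtain ⟨a, ha⟩ := exists_ne (0 : A)
    exact ha (hinj (by simp [h0]))
  exact Module.Finite.of_injective h (LinearMap.ker_eq_bot.1 hkh)

theorem cover_lift_surj {P P' X : Type u} [AddCommGroup P] [Module Λ P]
    [AddCommGroup P'] [Module Λ P'] [AddCommGroup X] [Module Λ X] [Nontrivial X]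
    (hu' : IsUniserialMod Λ P') (π : P →ₗ[Λ] X) (π' : P' →ₗ[Λ] X)
    (hπ : Function.Surjective π) (h : P →ₗ[Λ] P')
    (hh : π'.comp h = π) : Function.Surjective h := by
  have hh' : ∀ x, π' (h x) = π x := fun x => LinearMap.congr_fun hh x
  have hsup : LinearMap.range h ⊔ LinearMap.ker π' = ⊤ := by
    rw [eq_top_iff]
    intro x _
    obtain ⟨y, hy⟩ := hπ (π' x)
    have : x = h y + (x - h y) := by abel
    rw [this]
    exact Submodule.add_mem_sup ⟨y, rfl⟩ (by simp [hh', hy])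
  refine LinearMap.range_eq_top.1 ((uni_sup hu' hsup).resolve_right ?_)
  intro hk
  obtain ⟨y, hy⟩ := exists_ne (0 : X)
  obtain ⟨x, rfl⟩ := hπ y
  have : h x ∈ LinearMap.ker π' := hk ▸ trivial
  exact hy (by rw [← hh']; exact this)

/-- Uniqueness of projective covers. -/
theorem cover_unique [IsArtinianRing Λ] {P P' X : Type u} [AddCommGroup P] [Module Λ P]
    [AddCommGroup P'] [Module Λ P'] [AddCommGroup X] [Module Λ X] [Nontrivial X]
    [Module.Finite Λ P] [Module.Projective Λ P] [Module.Projective Λ P']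
    (hu : IsUniserialMod Λ P) (hu' : IsUniserialMod Λ P') (π : P →ₗ[Λ] X) (π' : P' →ₗ[Λ] X)
    (hπ : Function.Surjective π) (hπ' : Function.Surjective π') :
    ∃ e : P ≃ₗ[Λ] P', ∀ x, π' (e x) = π x := by
  obtain ⟨h, hh⟩ := Module.projective_lifting_property π' π hπ'
  obtain ⟨h', hh'⟩ := Module.projective_lifting_property π π' hπ
  have s1 := cover_lift_surj hu' π π' hπ h hh
  have s2 := cover_lift_surj hu π' π hπ' h' hh'
  have : Function.Injective (h'.comp h) :=
    IsNoetherian.injective_of_surjective_endomorphism _ (s2.comp s1)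
  have hinj : Function.Injective h := Function.Injective.of_comp (f := h') this
  exact ⟨LinearEquiv.ofBijective h ⟨hinj, s1⟩, fun x => LinearMap.congr_fun hh x⟩

/-- Finitely many isomorphism classes of simple modules. -/
theorem simple_coloring [IsArtinianRing Λ] (S : ℕ → ModuleCat.{u} Λ)
    (hS : ∀ k, IsSimpleModule Λ (S k)) :
    ∃ (F : Type u) (_ : Finite F) (c : ℕ → F), ∀ k l, c k = c l →
      Nonempty ((S k : Type u) ≃ₗ[Λ] S l) := by
  let B := Λ ⧸ Ring.jacobson Λ
  have hB : IsSemisimpleModule Λ B :=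
    (IsArtinian.isSemisimpleModule_iff_jacobson Λ B).2
      (Module.jacobson_quotient_jacobson Λ Λ)
  have key : ∀ k, ∃ C : Submodule Λ B, Nonempty (C ≃ₗ[Λ] S k) := by
    intro k
    have := hS k
    have := IsSimpleModule.nontrivial Λ (S k)
    obtain ⟨y, hy⟩ := exists_ne (0 : S k)
    let f : Λ →ₗ[Λ] S k := LinearMap.toSpanSingleton Λ (S k) y
    have hf : Function.Surjective f := IsSimpleModule.toSpanSingleton_surjective Λ hy
    have hker : Ring.jacobson Λ ≤ LinearMap.ker f := IsSemisimpleModule.jacobson_le_ker _ _ _ _ f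
    let g : B →ₗ[Λ] S k := Submodule.liftQ (Ring.jacobson Λ) f hker
    have hg : Function.Surjective g := by
      intro z
      obtain ⟨x, rfl⟩ := hf z
      exact ⟨Submodule.Quotient.mk x, rfl⟩
    obtain ⟨C, hC⟩ := exists_isCompl (LinearMap.ker g)
    exact ⟨C, ⟨(Submodule.quotientEquivOfIsCompl _ _ hC).symm.trans
      (g.quotKerEquivOfSurjective hg)⟩⟩
  choose C hC using key
  have hCs : ∀ k, IsSimpleModule Λ (C k) := fun k => by
    have := hS k
    exact IsSimpleModule.congr (hC k).some
  refine ⟨isotypicComponents Λ B, inferInstance,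
    fun k => ⟨isotypicComponent Λ B (C k), C k, hCs k, rfl⟩, ?_⟩
  intro k l hkl
  have hkl : isotypicComponent Λ B (C k) = isotypicComponent Λ B (C l) := congrArg Subtype.val hkl
  have := hCs k
  have := hCs l
  obtain ⟨e⟩ := isIsotypicOfType_submodule_iff.mp (IsIsotypicOfType.isotypicComponent Λ B (C l))
    (C k) (hkl ▸ (C k).le_isotypicComponent)
  exact ⟨(hC k).some.symm.trans (e.trans (hC l).some)⟩

theorem uni_finite_submodules [IsArtinianRing Λ] {A : Type u} [AddCommGroup A] [Module Λ A]
    [Module.Finite Λ A] (hu : IsUniserialMod Λ A) : Finite (Submodule Λ A) := by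
  classical
  let _ : LinearOrder (Submodule Λ A) :=
    { (inferInstance : PartialOrder (Submodule Λ A)) with
      le_total := hu
      min_def := fun a b => by
        split_ifs with h
        · exact inf_eq_left.2 h
        · exact inf_eq_right.2 ((hu a b).resolve_left h)
      max_def := fun a b => by
        split_ifs with h
        · exact sup_eq_right.2 h
        · exact sup_eq_left.2 ((hu a b).resolve_left h)
      toDecidableLE := Classical.decRel _ }
  exact Finite.of_wellFoundedLT_wellFoundedGT _

/-- Pigeonhole: among infinitely many indecomposables, two are isomorphic. -/
theorem pigeonhole [IsNakayama Λ] (M : ℕ → ModuleCat.{u} Λ) (hfin : ∀ k, Module.Finite Λ (M k))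
    (hind : ∀ k, IsIndecomposableMod Λ (M k)) :
    ∃ a b, a < b ∧ Nonempty ((M a : Type u) ≃ₗ[Λ] M b) := by
  have hnt := fun k => (hind k).1
  choose A π hAf hAp hAi hπ using fun k => exists_cover (Λ := Λ) (U := M k) (nak_uniserial (hind k))
  have hAnt := fun k => (hAi k).1
  have hAu := fun k => nak_uniserial (hAi k)
  choose S f hS hf using fun k => exists_simple_quot (Λ := Λ) (A k)
  obtain ⟨F, hF, c, hc⟩ := simple_coloring S hS
  obtain ⟨y, hy⟩ := Finite.exists_infinite_fiber c
  have hall : ∀ k ∈ c ⁻¹' {y}, ∀ l ∈ c ⁻¹' {y}, Nonempty ((A k : Type u) ≃ₗ[Λ] A l) := by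
    intro k hk l hl
    obtain ⟨e⟩ := hc k l (hk.trans hl.symm)
    have := hS l
    have := IsSimpleModule.nontrivial Λ (S l)
    obtain ⟨e', -⟩ := cover_unique (hAu k) (hAu l) (e.toLinearMap.comp (f k)) (f l)
      (e.surjective.comp (hf k)) (hf l)
    exact ⟨e'⟩
  obtain ⟨k₀⟩ : Nonempty (c ⁻¹' {y}) := inferInstance
  have := uni_finite_submodules (hAu k₀)
  let eq : ∀ k : c ⁻¹' {y}, (A k₀ : Type u) ≃ₗ[Λ] A k := fun k => (hall k₀ k₀.2 k k.2).some
  let p : ∀ k : c ⁻¹' {y}, A k₀ →ₗ[Λ] M k := fun k => (π k).comp (eq k).toLinearMap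
  have hp : ∀ k, Function.Surjective (p k) := fun k => (hπ k).comp (eq k).surjective
  obtain ⟨k, l, hkl, he⟩ := Finite.exists_ne_map_eq_of_infinite
    (fun k : c ⁻¹' {y} => LinearMap.ker (p k))
  have e : (M k : Type u) ≃ₗ[Λ] M l :=
    ((p k).quotKerEquivOfSurjective (hp k)).symm.trans
      ((Submodule.quotEquivOfEq _ _ he).trans ((p l).quotKerEquivOfSurjective (hp l)))
  have hne : (k : ℕ) ≠ l := fun h => hkl (Subtype.ext h)
  rcases lt_or_gt_of_ne hne with h | h
  · exact ⟨k, l, h, ⟨e⟩⟩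
  · exact ⟨l, k, h, ⟨e.symm⟩⟩

theorem factor_surj {A B C : Type u} [AddCommGroup A] [Module Λ A] [AddCommGroup B] [Module Λ B]
    [AddCommGroup C] [Module Λ C] (π : A →ₗ[Λ] B) (hπ : Function.Surjective π) (φ : A →ₗ[Λ] C)
    (h : ∀ x, π x = 0 → φ x = 0) : ∃ ψ : B →ₗ[Λ] C, ∀ x, ψ (π x) = φ x := by
  refine ⟨((LinearMap.ker π).liftQ φ (fun x hx => h x hx)).comp
    (π.quotKerEquivOfSurjective hπ).symm.toLinearMap, fun x => ?_⟩
  have : (π.quotKerEquivOfSurjective hπ).symm (π x) = (LinearMap.ker π).mkQ x := by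
    rw [LinearEquiv.symm_apply_eq]; rfl
  simp only [LinearMap.comp_apply, LinearEquiv.coe_coe]
  rw [this]
  rfl

/-- Short exact sequence `0 → A → P → B → 0` with `P` projective, along which maps
`A → Λ` extend. -/
def NakSES (A B : ModuleCat.{u} Λ) : Prop :=
  ∃ (P : ModuleCat.{u} Λ) (ι : A →ₗ[Λ] P) (π : P →ₗ[Λ] B), Module.Projective Λ P ∧
    Function.Injective ι ∧ Function.Surjective π ∧ Function.Exact ι π ∧
    ∀ φ : A →ₗ[Λ] Λ, ∃ ψ : P →ₗ[Λ] Λ, ψ.comp ι = φ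

theorem gp_chain {M : Type u} [AddCommGroup M] [Module Λ M] (h : IsGorensteinProjective Λ M) :
    ∃ N : ℤ → ModuleCat.{u} Λ, (∀ i, NakSES (N (i + 1)) (N i)) ∧ Nonempty (M ≃ₗ[Λ] N 0) := by
  obtain ⟨P, d, hP, hd, hext, hM⟩ := h
  refine ⟨fun i => ModuleCat.of Λ (LinearMap.range (d i)), fun i => ?_, hM⟩
  refine ⟨P (i + 1), (LinearMap.range (d (i + 1))).subtype, (d i).rangeRestrict, hP _,
    Submodule.subtype_injective _, LinearMap.surjective_rangeRestrict _, ?_, ?_⟩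
  · intro x
    have := hd i x
    constructor
    · intro hx
      have hx : d i x = 0 := congrArg Subtype.val hx
      obtain ⟨y, hy⟩ := this.1 hx
      exact ⟨⟨x, y, hy⟩, rfl⟩
    · rintro ⟨⟨_, y, rfl⟩, rfl⟩
      apply Subtype.ext
      exact this.2 ⟨y, rfl⟩
  · intro φ
    have hz : (φ.comp (d (i + 1)).rangeRestrict).comp (d (i + 1 + 1)) = 0 := by
      ext x
      have : (d (i + 1)).rangeRestrict (d (i + 1 + 1) x) = 0 := by
        apply Subtype.ext
        exact (hd (i + 1) _).2 ⟨x, rfl⟩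
      simp only [LinearMap.comp_apply, LinearMap.zero_apply]
      rw [this]
      exact map_zero φ
    obtain ⟨ψ, hψ⟩ := hext (i + 1) _ hz
    refine ⟨ψ, ?_⟩
    apply LinearMap.ext
    rintro ⟨_, y, rfl⟩
    exact LinearMap.congr_fun hψ y

theorem gp_of_chain {M : Type u} [AddCommGroup M] [Module Λ M] (N : ℤ → ModuleCat.{u} Λ)
    (hN : ∀ i, NakSES (N (i + 1)) (N i)) (hM : Nonempty (M ≃ₗ[Λ] N 1)) :
    IsGorensteinProjective Λ M := by
  choose P ι π hP hι hπ hex hext using hN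
  refine ⟨P, fun i => (ι i).comp (π (i + 1)), hP, ?_, ?_, ?_⟩
  · intro i x
    simp only [LinearMap.comp_apply]
    rw [← map_zero (ι i), (hι i).eq_iff, hex (i + 1) x]
    constructor
    · rintro ⟨y, rfl⟩
      obtain ⟨z, rfl⟩ := hπ (i + 1 + 1) y
      exact ⟨z, rfl⟩
    · rintro ⟨z, rfl⟩
      exact ⟨_, rfl⟩
  · intro i φ hφ
    obtain ⟨φ', hφ'⟩ := factor_surj (π (i + 1)) (hπ (i + 1)) φ (by
      intro x hx
      obtain ⟨y, rfl⟩ := (hex (i + 1) x).1 hx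
      obtain ⟨z, rfl⟩ := hπ (i + 1 + 1) y
      exact LinearMap.congr_fun hφ z)
    obtain ⟨ψ, hψ⟩ := hext i φ'
    refine ⟨ψ, ?_⟩
    ext x
    rw [← hφ' x, ← hψ]
    rfl
  · obtain ⟨e⟩ := hM
    have hr : LinearMap.range (ι 0) = LinearMap.range ((ι 0).comp (π (0 + 1))) := by
      rw [LinearMap.range_comp, LinearMap.range_eq_top.2 (hπ _), Submodule.map_top]
    exact ⟨e.trans ((LinearEquiv.ofInjective (ι 0) (hι 0)).trans (LinearEquiv.ofEq _ _ hr))⟩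

theorem NakSES.congr {A A' B B' : ModuleCat.{u} Λ} (h : NakSES A B)
    (e : (A' : Type u) ≃ₗ[Λ] A) (e' : (B : Type u) ≃ₗ[Λ] B') : NakSES A' B' := by
  obtain ⟨P, ι, π, hP, hι, hπ, hex, hext⟩ := h
  refine ⟨P, ι.comp e.toLinearMap, e'.toLinearMap.comp π, hP, hι.comp e.injective,
    e'.surjective.comp hπ, ?_, ?_⟩
  · intro x
    simp only [LinearMap.comp_apply, LinearEquiv.coe_coe, LinearEquiv.map_eq_zero_iff]
    rw [hex x]
    constructor
    · rintro ⟨y, rfl⟩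
      exact ⟨e.symm y, by simp⟩
    · rintro ⟨y, rfl⟩
      exact ⟨_, rfl⟩
  · intro φ
    obtain ⟨ψ, hψ⟩ := hext (φ.comp e.symm.toLinearMap)
    refine ⟨ψ, ?_⟩
    rw [← LinearMap.comp_assoc, hψ]
    ext x; simp

/-- The easier direction. -/
theorem gp_of_periodic [IsNakayama Λ] {M : Type u} [AddCommGroup M] [Module Λ M]
    (h : HasPeriodicMinimalResolution Λ M) : IsGorensteinProjective Λ M := by
  obtain ⟨n, C, f, hn, ⟨e0⟩, ⟨e1⟩, hmin, hinj, hsurj, hex⟩ := h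
  let K : ℕ → ModuleCat.{u} Λ := fun j => ModuleCat.of Λ (LinearMap.range (f j))
  have hK : ∀ j, j + 1 ≤ n → NakSES (K (j + 1)) (K j) := by
    intro j hj
    have hm := hmin (j + 1) (by omega) hj
    have hfin := finite_of_indec_proj hm.1 hm.2.1
    refine ⟨C (j + 1), (LinearMap.range (f (j + 1))).subtype, (f j).rangeRestrict, hm.1,
      Submodule.subtype_injective _, LinearMap.surjective_rangeRestrict _, ?_,
      fun φ => minproj_ext hm _ (Submodule.subtype_injective _) φ⟩
    intro x
    have := hex j hj x
    constructor
    · intro hx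
      have hx : f j x = 0 := congrArg Subtype.val hx
      obtain ⟨y, hy⟩ := this.1 hx
      exact ⟨⟨x, y, hy⟩, rfl⟩
    · rintro ⟨⟨_, y, rfl⟩, rfl⟩
      apply Subtype.ext
      exact this.2 ⟨y, rfl⟩
  have k0 : (K 0 : Type u) ≃ₗ[Λ] M :=
    (LinearEquiv.ofTop _ (LinearMap.range_eq_top.2 hsurj)).trans e0
  have kn : (K n : Type u) ≃ₗ[Λ] M := (LinearEquiv.ofInjective (f n) hinj).symm.trans e1
  refine gp_of_chain (fun i : ℤ => K ((i - 1) % (n : ℤ)).toNat) (fun i => ?_) ?_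
  · have hlt := Int.emod_lt_of_pos (i - 1) (show (0 : ℤ) < n by omega)
    have hnn := Int.emod_nonneg (i - 1) (show (n : ℤ) ≠ 0 by omega)
    obtain ⟨r, hr⟩ := Int.eq_ofNat_of_zero_le hnn
    have hrn : r + 1 ≤ n := by omega
    have h1 : ((i - 1) % (n : ℤ)).toNat = r := by omega
    have hs : (i + 1 - 1) % (n : ℤ) = ((r : ℤ) + 1) % n := by
      rw [show i + 1 - 1 = (i - 1) + 1 by ring, Int.add_emod, hr]
      simp [Int.add_emod]
    change NakSES (K ((i + 1 - 1) % (n : ℤ)).toNat) (K ((i - 1) % (n : ℤ)).toNat)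
    rw [h1, hs]
    rcases eq_or_lt_of_le hrn with h | h
    · have : (((r : ℤ) + 1) % n).toNat = 0 := by
        have : (r : ℤ) + 1 = n := by omega
        rw [this]; simp
      rw [this]
      refine (hK r hrn).congr ?_ (LinearEquiv.refl _ _)
      rw [h]
      exact k0.trans kn.symm
    · have : (((r : ℤ) + 1) % n).toNat = r + 1 := by
        rw [Int.emod_eq_of_lt (by omega) (by omega)]; omega
      rw [this]
      exact hK r hrn
  · have : (((1 : ℤ) - 1) % (n : ℤ)).toNat = 0 := by simp
    change Nonempty (M ≃ₗ[Λ] K (((1 : ℤ) - 1) % (n : ℤ)).toNat)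
    rw [this]
    exact ⟨k0.symm⟩

/-- A map from a finite module to a projective module factors through a finite projective. -/
theorem factor_fin {X R : Type u} [AddCommGroup X] [Module Λ X] [AddCommGroup R] [Module Λ R]
    [Module.Finite Λ X] [hR : Module.Projective Λ R] (φ : X →ₗ[Λ] R) :
    ∃ (E : ModuleCat.{u} Λ) (α : X →ₗ[Λ] E) (β : E →ₗ[Λ] R), Module.Finite Λ E ∧
      Module.Projective Λ E ∧ ∀ x, β (α x) = φ x := by
  classical
  obtain ⟨s, hs⟩ := hR.out
  obtain ⟨g, hg⟩ := (Module.Finite.fg_top : (⊤ : Submodule Λ X).FG)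
  let t : Finset R := g.biUnion (fun x => (s (φ x)).support)
  have ht : ∀ x, s (φ x) ∈ Finsupp.supported Λ Λ (t : Set R) := by
    have : (⊤ : Submodule Λ X) ≤ (Finsupp.supported Λ Λ (t : Set R)).comap (s.comp φ) := by
      rw [← hg, Submodule.span_le]
      intro x hx
      change s (φ x) ∈ Finsupp.supported Λ Λ (t : Set R)
      rw [Finsupp.mem_supported]
      exact_mod_cast Finset.subset_biUnion_of_mem (fun x => (s (φ x)).support) hx
    exact fun x => this trivial
  let e := Finsupp.supportedEquivFinsupp (M := Λ) (R := Λ) (t : Set R)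
  refine ⟨ModuleCat.of Λ ((t : Set R) →₀ Λ),
    e.toLinearMap.comp ((s.comp φ).codRestrict _ ht),
    ((Finsupp.linearCombination Λ id).comp (Submodule.subtype _)).comp e.symm.toLinearMap,
    inferInstanceAs (Module.Finite Λ ((t : Set R) →₀ Λ)),
    inferInstanceAs (Module.Projective Λ ((t : Set R) →₀ Λ)), fun x => ?_⟩
  simp only [LinearMap.comp_apply, LinearEquiv.coe_coe]
  erw [e.symm_apply_apply]
  exact hs (φ x)

theorem minproj_ext_any [IsNakayama Λ] {X P R : Type u} [AddCommGroup P] [Module Λ P]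
    [AddCommGroup X] [Module Λ X] [AddCommGroup R] [Module Λ R]
    [Module.Finite Λ P] [Module.Finite Λ X] (hP : IsMinimalProjective Λ P) (ι : X →ₗ[Λ] P)
    (hι : Function.Injective ι) [Module.Projective Λ R]
    (φ : X →ₗ[Λ] R) : ∃ ψ : P →ₗ[Λ] R, ∀ x, ψ (ι x) = φ x := by
  obtain ⟨E, α, β, hE, hE', h⟩ := factor_fin φ
  obtain ⟨ψ, hψ⟩ := minproj_ext hP ι hι α
  refine ⟨β.comp ψ, fun x => ?_⟩
  rw [← h x, ← hψ]
  rfl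

theorem ext_to_finite {A P F : Type u} [AddCommGroup A] [Module Λ A] [AddCommGroup P] [Module Λ P]
    [AddCommGroup F] [Module Λ F] [Module.Finite Λ F] [Module.Projective Λ F] (ι : A →ₗ[Λ] P)
    (hext : ∀ φ : A →ₗ[Λ] Λ, ∃ ψ : P →ₗ[Λ] Λ, ψ.comp ι = φ) (φ : A →ₗ[Λ] F) :
    ∃ ψ : P →ₗ[Λ] F, ∀ x, ψ (ι x) = φ x := by
  obtain ⟨n, f, hf⟩ := Module.Finite.exists_fin' Λ F
  obtain ⟨s, hs⟩ := Module.projective_lifting_property f LinearMap.id hf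
  choose ψ hψ using fun i : Fin n => hext ((LinearMap.proj i).comp (s.comp φ))
  refine ⟨f.comp (LinearMap.pi ψ), fun x => ?_⟩
  have : LinearMap.pi ψ (ι x) = s (φ x) := by
    funext i
    exact LinearMap.congr_fun (hψ i) x
  rw [LinearMap.comp_apply, this]
  exact LinearMap.congr_fun hs (φ x)

/-- Embedding into a minimal projective. -/
theorem exists_minproj_embedding [IsNakayama Λ] {M R : Type u} [AddCommGroup M] [Module Λ M]
    [AddCommGroup R] [Module Λ R] [Module.Finite Λ M] (hM : IsIndecomposableMod Λ M)
    (hnp : ¬ Module.Projective Λ M) [Module.Projective Λ R] (φ : M →ₗ[Λ] R)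
    (hφ : Function.Injective φ) :
    ∃ (P : ModuleCat.{u} Λ) (ι : M →ₗ[Λ] P), Module.Finite Λ P ∧ IsMinimalProjective Λ P ∧
      Function.Injective ι := by
  have hMu := nak_uniserial hM
  have := hM.1
  obtain ⟨E, α, β, hE, hE', h⟩ := factor_fin φ
  have hα : Function.Injective α := fun x y hxy => hφ (by rw [← h x, ← h y, hxy])
  obtain ⟨A, r, hr, hκ, hA⟩ := exists_summand_inj hMu α hα
  have hAp := summand_projective A r hr
  have hAu := nak_uniserial hA
  set κ : M →ₗ[Λ] A := r.comp α with hκdef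
  let S : Set (Submodule Λ A) := {B | Module.Projective Λ B ∧ LinearMap.range κ ≤ B}
  have hne : S.Nonempty := ⟨⊤, Module.Projective.of_equiv (Submodule.topEquiv (R := Λ) (M := A)).symm,
    le_top⟩
  obtain ⟨B, ⟨hBp, hB⟩, hBmin⟩ := wellFounded_lt.has_min S hne
  let ι : M →ₗ[Λ] B := κ.codRestrict B (fun x => hB ⟨x, rfl⟩)
  have hι : Function.Injective ι := fun x y hxy => hκ (congrArg Subtype.val hxy)
  have hBnt : Nontrivial B := hι.nontrivial
  have hBu : IsUniserialMod Λ B := uni_of_injective hAu B.subtype B.subtype_injective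
  refine ⟨ModuleCat.of Λ B, ι, inferInstanceAs (Module.Finite Λ B), ⟨hBp, uni_indec hBu, ?_⟩, hι⟩
  intro hrad
  change Module.Projective Λ (modRadical Λ B) at hrad
  have hιne : LinearMap.range ι ≠ ⊤ := by
    intro htop
    exact hnp (Module.Projective.of_equiv
      (LinearEquiv.ofBijective ι ⟨hι, LinearMap.range_eq_top.1 htop⟩).symm)
  have hle := uni_le_rad hBu hιne
  have hlt : (modRadical Λ B).map B.subtype < B := by
    refine lt_of_le_of_ne (Submodule.map_subtype_le _ _) fun heq => ?_
    apply rad_ne_top (Λ := Λ) (M := B)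
    rw [eq_top_iff]
    rintro ⟨x, hx⟩ -
    obtain ⟨y, hy, hyx⟩ := (heq.ge hx : x ∈ (modRadical Λ B).map B.subtype)
    have : y = ⟨x, hx⟩ := Subtype.ext hyx
    exact this ▸ hy
  refine hBmin _ ⟨?_, ?_⟩ hlt
  · exact Module.Projective.of_equiv
      (Submodule.equivMapOfInjective B.subtype B.subtype_injective (modRadical Λ B))
  · rintro _ ⟨x, rfl⟩
    exact ⟨ι x, hle ⟨x, rfl⟩, rfl⟩

/-- The identity of `M` factors through `N` up to a map through a finite projective. -/
def NakJ (M N : ModuleCat.{u} Λ) : Prop :=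
  ∃ (F : ModuleCat.{u} Λ) (g : M →ₗ[Λ] N) (h : N →ₗ[Λ] M) (a : M →ₗ[Λ] F) (b : F →ₗ[Λ] M),
    Module.Finite Λ F ∧ Module.Projective Λ F ∧ ∀ x, h (g x) + b (a x) = x

/-- Short exact sequence with minimal projective middle term. -/
def MinSES (A B : ModuleCat.{u} Λ) : Prop :=
  ∃ (P : ModuleCat.{u} Λ) (ι : A →ₗ[Λ] P) (π : P →ₗ[Λ] B), Module.Finite Λ P ∧
    IsMinimalProjective Λ P ∧ Function.Injective ι ∧ Function.Surjective π ∧ Function.Exact ι π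

/-- Finite, indecomposable, non-projective. -/
def NakGood (M : ModuleCat.{u} Λ) : Prop :=
  Module.Finite Λ M ∧ IsIndecomposableMod Λ M ∧ ¬ Module.Projective Λ M

theorem nak_step [IsNakayama Λ] {M N N' : ModuleCat.{u} Λ} (hM : NakGood M) (hJ : NakJ M N)
    (hN : NakSES N N') : ∃ M' : ModuleCat.{u} Λ, NakGood M' ∧ NakJ M' N' ∧ MinSES M M' := by
  obtain ⟨hfin, hind, hnp⟩ := hM
  obtain ⟨F, g, h, a, b, hF, hFp, hid⟩ := hJ
  obtain ⟨P₀, ι₀, π₀, hP₀, hι₀, hπ₀, hex₀, hext⟩ := hN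
  have hMnt := hind.1
  obtain ⟨P, ι, hPfin, hPm, hι⟩ := exists_minproj_embedding (R := P₀ × F) hind hnp
    ((ι₀.comp g).prod a) (by
      intro x y hxy
      have h1 : ι₀ (g x) = ι₀ (g y) := congrArg Prod.fst hxy
      have h2 : a x = a y := congrArg Prod.snd hxy
      rw [← hid x, ← hid y, hι₀ h1, h2])
  have hPp := hPm.1
  have hPu := nak_uniserial hPm.2.1
  let M' : ModuleCat.{u} Λ := ModuleCat.of Λ (P ⧸ LinearMap.range ι)
  let π : P →ₗ[Λ] M' := (LinearMap.range ι).mkQ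
  have hπ : Function.Surjective π := Submodule.mkQ_surjective _
  have hker : ∀ x, π x = 0 ↔ x ∈ LinearMap.range ι := fun x => Submodule.Quotient.mk_eq_zero _
  have hex : Function.Exact ι π := fun x => hker x
  have hne : LinearMap.range ι ≠ ⊤ := by
    intro htop
    exact hnp (Module.Projective.of_equiv
      (LinearEquiv.ofBijective ι ⟨hι, LinearMap.range_eq_top.1 htop⟩).symm)
  have hM'nt : Nontrivial M' := Submodule.Quotient.nontrivial_iff.2 hne
  have hM'fin : Module.Finite Λ M' := Module.Finite.of_surjective π hπ
  have hM'u : IsUniserialMod Λ M' := uni_of_surjective hPu π hπ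
  refine ⟨M', ⟨hM'fin, uni_indec hM'u, ?_⟩, ?_, P, ι, π, hPfin, hPm, hι, hπ, hex⟩
  · intro hproj
    have hinj := uni_inj_of_projective hPu π hπ
    obtain ⟨x, hx⟩ := exists_ne (0 : M)
    apply hx
    apply hι
    apply hinj
    rw [map_zero, map_zero]
    exact (hker _).2 ⟨x, rfl⟩
  · obtain ⟨p, hp⟩ := minproj_ext_any hPm ι hι (ι₀.comp g)
    obtain ⟨q, hq⟩ := ext_to_finite ι₀ hext (ι.comp h)
    obtain ⟨a', ha'⟩ := minproj_ext_any hPm ι hι a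
    obtain ⟨c, hc⟩ := factor_surj π hπ (LinearMap.id - q.comp p - (ι.comp b).comp a') (by
      intro x hx
      obtain ⟨y, rfl⟩ := (hker x).1 hx
      simp only [LinearMap.sub_apply, LinearMap.comp_apply, LinearMap.id_apply, hp, hq, ha']
      conv_lhs => enter [1, 1]; rw [← hid y]
      rw [map_add]; abel)
    obtain ⟨g', hg'⟩ := factor_surj π hπ (π₀.comp p) (by
      intro x hx
      obtain ⟨y, rfl⟩ := (hker x).1 hx
      rw [LinearMap.comp_apply, hp]
      exact (hex₀ _).2 ⟨_, rfl⟩)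
    obtain ⟨h', hh'⟩ := factor_surj π₀ hπ₀ (π.comp q) (by
      intro x hx
      obtain ⟨y, rfl⟩ := (hex₀ x).1 hx
      rw [LinearMap.comp_apply, hq]
      exact (hker _).2 ⟨_, rfl⟩)
    refine ⟨P, g', h', c, π, hPfin, hPp, fun x => ?_⟩
    obtain ⟨y, rfl⟩ := hπ x
    rw [hg', hc, LinearMap.comp_apply, hh']
    simp only [LinearMap.sub_apply, LinearMap.comp_apply, LinearMap.id_apply, map_sub]
    rw [(hker (ι (b (a' y)))).2 ⟨_, rfl⟩]
    abel

theorem minSES_cancel [IsNakayama Λ] {A A' B B' : ModuleCat.{u} Λ} [hB : Nontrivial B]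
    (h : MinSES A B) (h' : MinSES A' B') (e : (B : Type u) ≃ₗ[Λ] B') :
    Nonempty ((A : Type u) ≃ₗ[Λ] A') := by
  obtain ⟨P, ι, π, hf, hm, hι, hπ, hex⟩ := h
  obtain ⟨P', ι', π', hf', hm', hι', hπ', hex'⟩ := h'
  have := hm.1
  have := hm'.1
  obtain ⟨E, hE⟩ := cover_unique (nak_uniserial hm.2.1) (nak_uniserial hm'.2.1) π
    (e.symm.toLinearMap.comp π') hπ (e.symm.surjective.comp hπ')
  have hE' : ∀ x, π' (E x) = e (π x) := fun x => by rw [← hE x]; simp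
  have hmap : (LinearMap.range ι).map (E : P →ₗ[Λ] P') = LinearMap.range ι' := by
    ext y
    constructor
    · rintro ⟨_, ⟨x, rfl⟩, rfl⟩
      refine (hex' _).1 ?_
      have := hE' (ι x)
      rw [(hex (ι x)).2 ⟨x, rfl⟩, map_zero] at this
      exact this
    · intro hy
      have h0 := (hex' y).2 hy
      refine ⟨E.symm y, (hex _).1 ?_, E.apply_symm_apply y⟩
      apply e.injective
      rw [← hE', map_zero, E.apply_symm_apply, h0]
  exact ⟨(LinearEquiv.ofInjective ι hι).trans ((E.submoduleMap _).trans
    ((LinearEquiv.ofEq _ _ hmap).trans (LinearEquiv.ofInjective ι' hι').symm))⟩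

def nakC (K : ModuleCat.{u} Λ) (P : ℕ → ModuleCat.{u} Λ) : ℕ → ModuleCat.{u} Λ
  | 0 => K
  | j + 1 => P j

def nakD (K P : ℕ → ModuleCat.{u} Λ) (ι : ∀ j, K (j + 1) →ₗ[Λ] P j) (π : ∀ j, P j →ₗ[Λ] K j) :
    ∀ i, nakC (K 0) P (i + 1) →ₗ[Λ] nakC (K 0) P i
  | 0 => π 0
  | j + 1 => (ι j).comp (π (j + 1))

theorem periodic_of_gp [IsNakayama Λ] {M : Type u} [AddCommGroup M] [Module Λ M]
    (hfin : Module.Finite Λ M) (hind : IsIndecomposableMod Λ M) (hnp : ¬ Module.Projective Λ M)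
    (hgp : IsGorensteinProjective Λ M) : HasPeriodicMinimalResolution Λ M := by
  obtain ⟨N, hN, ⟨e⟩⟩ := gp_chain hgp
  let T : ℕ → Type (u + 1) := fun k => {X : ModuleCat.{u} Λ // NakGood X ∧ NakJ X (N (-(k : ℤ)))}
  have hstep : ∀ k (X : T k), ∃ Y : T (k + 1), MinSES X.1 Y.1 := by
    rintro k ⟨X, hX, hJ⟩
    have hs : NakSES (N (-(k : ℤ))) (N (-((k + 1 : ℕ) : ℤ))) := by
      have := hN (-((k + 1 : ℕ) : ℤ))
      rwa [show (-((k + 1 : ℕ) : ℤ)) + 1 = -(k : ℤ) by push_cast; ring] at this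
    obtain ⟨Y, h1, h2, h3⟩ := nak_step hX hJ hs
    exact ⟨⟨Y, h1, h2⟩, h3⟩
  choose nxt hnxt using hstep
  let X0 : T 0 := ⟨ModuleCat.of Λ M, ⟨hfin, hind, hnp⟩, ModuleCat.of Λ PUnit.{u + 1}, e.toLinearMap,
    e.symm.toLinearMap, 0, 0, inferInstanceAs (Module.Finite Λ PUnit.{u + 1}),
    inferInstanceAs (Module.Projective Λ PUnit.{u + 1}), fun x => by
      simp only [LinearMap.zero_apply, add_zero]
      exact e.symm_apply_apply x⟩
  let X : ∀ k, T k := fun k => Nat.rec X0 (fun k Y => nxt k Y) k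
  let Q : ℕ → ModuleCat.{u} Λ := fun k => (X k).1
  have hQ0 : Q 0 = ModuleCat.of Λ M := rfl
  have hQ : ∀ k, MinSES (Q k) (Q (k + 1)) := fun k => hnxt k (X k)
  have hgood : ∀ k, NakGood (Q k) := fun k => (X k).2.1
  clear_value Q
  obtain ⟨i, j, hij, ⟨f⟩⟩ := pigeonhole Q (fun k => (hgood k).1) (fun k => (hgood k).2.1)
  obtain ⟨n, hn, rfl⟩ : ∃ n, 1 ≤ n ∧ j = i + n := ⟨j - i, by omega, by omega⟩
  have hback : ∀ i, Nonempty ((Q i : Type u) ≃ₗ[Λ] Q (i + n)) →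
      Nonempty ((Q 0 : Type u) ≃ₗ[Λ] Q n) := by
    intro i
    induction i with
    | zero => intro h; rwa [Nat.zero_add] at h
    | succ i ih =>
      rintro ⟨f⟩
      apply ih
      have := (hgood (i + 1)).2.1.1
      have h2 := hQ (i + n)
      rw [show i + n + 1 = i + 1 + n by omega] at h2
      exact minSES_cancel (hQ i) h2 f
  obtain ⟨e0⟩ := hback i ⟨f⟩
  let K : ℕ → ModuleCat.{u} Λ := fun j => if j ≤ n then Q (n - j) else ModuleCat.of Λ PUnit.{u + 1}
  have hK0 : K 0 = Q n := by simp [K]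
  have hKn : K n = Q 0 := by simp [K]
  have hKs : ∀ j, j < n → MinSES (K (j + 1)) (K j) := by
    intro j hj
    have := hQ (n - (j + 1))
    rw [show n - (j + 1) + 1 = n - j by omega] at this
    simpa [K, show j + 1 ≤ n from hj, hj.le] using this
  have hKbig : ∀ j, n ≤ j → Subsingleton (K (j + 1)) := by
    intro j hj
    have : K (j + 1) = ModuleCat.of Λ PUnit.{u + 1} := if_neg (by omega)
    rw [this]
    exact inferInstanceAs (Subsingleton PUnit.{u + 1})
  have hall : ∀ j, ∃ (P : ModuleCat.{u} Λ) (ι : K (j + 1) →ₗ[Λ] P) (π : P →ₗ[Λ] K j),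
      Function.Injective ι ∧ Function.Surjective π ∧ Function.Exact ι π ∧
      (j < n → IsMinimalProjective Λ P) ∧ (n ≤ j → Function.Injective π) := by
    intro j
    by_cases hj : j < n
    · obtain ⟨P, ι, π, -, h1, h2, h3, h4⟩ := hKs j hj
      exact ⟨P, ι, π, h2, h3, h4, fun _ => h1, fun h => absurd hj (by omega)⟩
    · have := hKbig j (by omega)
      refine ⟨K j, 0, LinearMap.id, fun x y _ => Subsingleton.elim _ _, fun x => ⟨x, rfl⟩, ?_,
        fun h => absurd h hj, fun _ x y h => h⟩
      intro x
      constructor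
      · intro h
        exact ⟨0, h.symm⟩
      · rintro ⟨y, rfl⟩
        rfl
  clear_value K
  choose P ι π hι hπ hex hmin hinj using hall
  let C : ℕ → ModuleCat.{u} Λ := nakC (K 0) P
  let d : ∀ i, C (i + 1) →ₗ[Λ] C i := nakD K P ι π
  refine ⟨n, C, d, hn, ?_, ?_, ?_, ?_, ?_, ?_⟩
  · change Nonempty ((K 0 : Type u) ≃ₗ[Λ] M)
    rw [hK0]
    rw [hQ0] at e0
    exact ⟨e0.symm⟩
  · change Nonempty ((P n : Type u) ≃ₗ[Λ] M)
    have e1 := LinearEquiv.ofBijective (π n) ⟨hinj n le_rfl, hπ n⟩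
    rw [hKn, hQ0] at e1
    exact ⟨e1⟩
  · intro i h1 h2
    obtain ⟨i, rfl⟩ : ∃ k, i = k + 1 := ⟨i - 1, by omega⟩
    exact hmin i (by omega)
  · obtain ⟨m, rfl⟩ : ∃ k, n = k + 1 := ⟨n - 1, by omega⟩
    exact (hι m).comp (hinj (m + 1) le_rfl)
  · exact hπ 0
  · intro j _
    have key : ∀ x, π j x = 0 ↔ x ∈ Set.range ((ι j).comp (π (j + 1))) := by
      intro x
      rw [hex j x]
      constructor
      · rintro ⟨y, rfl⟩
        obtain ⟨z, rfl⟩ := hπ (j + 1) y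
        exact ⟨z, rfl⟩
      · rintro ⟨z, rfl⟩
        exact ⟨_, rfl⟩
    cases j with
    | zero => exact key
    | succ j =>
      intro x
      change ι j (π (j + 1) x) = 0 ↔ _
      rw [← map_zero (ι j), (hι j).eq_iff]
      exact key x

end Helpers

/-- An indecomposable non-projective module `M` over a Nakayama algebra is Gorenstein
projective if and only if there is an exact sequence
`0 → M → P_{n-1} → ⋯ → P_0 → M → 0` in which all `P_i` are minimal projective. -/
theorem gorenstein_projective_iff_periodic_minimal_resolution [IsNakayama Λ]
    (h0 : NoSimpleProjectives Λ)
    (M : Type u) [AddCommGroup M] [Module Λ M]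
    (hfl : ∃ n, HasLength Λ M n) (hind : IsIndecomposableMod Λ M)
    (hnp : ¬ Module.Projective Λ M) :
    IsGorensteinProjective Λ M ↔ HasPeriodicMinimalResolution Λ M := by
  exact ⟨periodic_of_gp (nak_finite_of_hasLength hfl) hind hnp, gp_of_periodic⟩
end
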